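/- For t ∈ (a,b], let H^P_t be the space of piecewise C¹ maps V : [a,t] → E with V(a) ∈ W and V(t) = 0, let I^P_t(V,U) = ∫_a^t (⟪V'(s), U'(s)⟫ + ⟪S(s) V(s), U(s)⟫) ds − σ(V(a), U(a)), and set i(t) = ind(I^P_t, H^P_t). Then: (1) i is left continuous on (a,b], i.e. for every t ∈ (a,b] there is ε > 0 such that i(s) = i(t) for all s ∈ (t−ε, t] ∩ (a,b]; and (2) for every t ∈ (a,b) there is ε > 0 such that i(s) = i(t) + μ^P(t) for all s ∈ (t, t+ε) ∩ (a,b]. -/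

import Mathlib

open Set

/-- `J` is a Jacobi field (in the ODE model) with derivative `J'`:
`J` is twice differentiable and `J'' = S J`. -/
def IsJacobiPair {n : ℕ} (S : ℝ → EuclideanSpace ℝ (Fin n) →L[ℝ] EuclideanSpace ℝ (Fin n))
    (J J' : ℝ → EuclideanSpace ℝ (Fin n)) : Prop :=
  (∀ t, HasDerivAt J (J' t) t) ∧ ∀ t, HasDerivAt J' (S t (J t)) t

/-- `J` is a `P`-Jacobi field with derivative `J'`: a Jacobi field with `J a ∈ W` and
`⟪J' a, w⟫ + σ (J a) w = 0` for all `w ∈ W`. -/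
def IsPJacobiPair {n : ℕ} (S : ℝ → EuclideanSpace ℝ (Fin n) →L[ℝ] EuclideanSpace ℝ (Fin n))
    (σ : EuclideanSpace ℝ (Fin n) →ₗ[ℝ] EuclideanSpace ℝ (Fin n) →ₗ[ℝ] ℝ)
    (W : Submodule ℝ (EuclideanSpace ℝ (Fin n))) (a : ℝ)
    (J J' : ℝ → EuclideanSpace ℝ (Fin n)) : Prop :=
  IsJacobiPair S J J' ∧ J a ∈ W ∧ ∀ w ∈ W, (inner ℝ (J' a) w : ℝ) + σ (J a) w = 0

/-- `V` is piecewise `C¹` on `[a, b]`: continuous on `[a, b]` and `C¹` on each of the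
closed subintervals of some partition `a = s₀ < s₁ < … < s_k = b`. -/
def PiecewiseC1On {F : Type*} [NormedAddCommGroup F] [NormedSpace ℝ F]
    (a b : ℝ) (V : ℝ → F) : Prop :=
  ContinuousOn V (Icc a b) ∧
  ∃ (k : ℕ) (s : Fin (k + 1) → ℝ), s 0 = a ∧ s (Fin.last k) = b ∧ StrictMono s ∧
    ∀ i : Fin k, ContDiffOn ℝ 1 V (Icc (s i.castSucc) (s i.succ))

/-- The index form `I^P` on `[a, b]`. -/
noncomputable def indexForm {n : ℕ}
    (S : ℝ → EuclideanSpace ℝ (Fin n) →L[ℝ] EuclideanSpace ℝ (Fin n))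
    (σ : EuclideanSpace ℝ (Fin n) →ₗ[ℝ] EuclideanSpace ℝ (Fin n) →ₗ[ℝ] ℝ)
    (a b : ℝ) (V U : ℝ → EuclideanSpace ℝ (Fin n)) : ℝ :=
  (∫ t in a..b, ((inner ℝ (deriv V t) (deriv U t) : ℝ) + (inner ℝ (S t (V t)) (U t) : ℝ))) -
    σ (V a) (U a)


/-- The space `H^P_t` of piecewise `C¹` maps `V` on `[a, t]` with `V a ∈ W` and `V t = 0`. -/
def HPt {n : ℕ} (W : Submodule ℝ (EuclideanSpace ℝ (Fin n))) (a t : ℝ) :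
    Set (ℝ → EuclideanSpace ℝ (Fin n)) :=
  {V | PiecewiseC1On a t V ∧ V a ∈ W ∧ V t = 0}

/-- The index of a (not necessarily bilinear) form `B` on the set `K`: the supremum of the
dimensions of the finite-dimensional subspaces contained in `K` on which `B` is negative
definite, as an element of `ℕ∞`. -/
noncomputable def indexOn {X : Type*} [AddCommGroup X] [Module ℝ X]
    (B : X → X → ℝ) (K : Set X) : ℕ∞ :=
  ⨆ (U : Submodule ℝ X) (_ : (U : Set X) ⊆ K ∧ FiniteDimensional ℝ U ∧
      ∀ v ∈ U, v ≠ 0 → B v v < 0), (Module.finrank ℝ U : ℕ∞)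

/-- The restricted Morse index function `i(t) = ind (I^P_{[a,t]}, H^P_t)`. -/
noncomputable def morseIndexFun {n : ℕ}
    (S : ℝ → EuclideanSpace ℝ (Fin n) →L[ℝ] EuclideanSpace ℝ (Fin n))
    (σ : EuclideanSpace ℝ (Fin n) →ₗ[ℝ] EuclideanSpace ℝ (Fin n) →ₗ[ℝ] ℝ)
    (W : Submodule ℝ (EuclideanSpace ℝ (Fin n))) (a t : ℝ) : ℕ∞ :=
  indexOn (indexForm S σ a t) (HPt W a t)

/-- The space of `P`-Jacobi fields (encoded as pairs `(J, J')`) vanishing at the instant `t`. -/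
def pJacobiVanishingAt {n : ℕ}
    (S : ℝ → EuclideanSpace ℝ (Fin n) →L[ℝ] EuclideanSpace ℝ (Fin n))
    (σ : EuclideanSpace ℝ (Fin n) →ₗ[ℝ] EuclideanSpace ℝ (Fin n) →ₗ[ℝ] ℝ)
    (W : Submodule ℝ (EuclideanSpace ℝ (Fin n))) (a t : ℝ) :
    Submodule ℝ ((ℝ → EuclideanSpace ℝ (Fin n)) × (ℝ → EuclideanSpace ℝ (Fin n))) where
  carrier := {p | IsPJacobiPair S σ W a p.1 p.2 ∧ p.1 t = 0}
  zero_mem' := by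
    refine ⟨⟨⟨fun s => ?_, fun s => ?_⟩, W.zero_mem, fun w hw => by simp⟩, rfl⟩
    · exact hasDerivAt_const s 0
    · simpa using hasDerivAt_const s (0 : EuclideanSpace ℝ (Fin n))
  add_mem' := by
    rintro p q ⟨⟨⟨hp1, hp2⟩, hpa, hpσ⟩, hpt⟩ ⟨⟨⟨hq1, hq2⟩, hqa, hqσ⟩, hqt⟩
    refine ⟨⟨⟨fun s => ?_, fun s => ?_⟩, W.add_mem hpa hqa, fun w hw => ?_⟩, ?_⟩
    · exact (hp1 s).add (hq1 s)
    · simpa using (hp2 s).add (hq2 s)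
    · have h1 := hpσ w hw
      have h2 := hqσ w hw
      simp only [Prod.fst_add, Prod.snd_add, Pi.add_apply, inner_add_left, map_add,
        LinearMap.add_apply] at *
      linarith
    · simp [Prod.fst_add, Pi.add_apply, hpt, hqt]
  smul_mem' := by
    rintro c p ⟨⟨⟨hp1, hp2⟩, hpa, hpσ⟩, hpt⟩
    refine ⟨⟨⟨fun s => ?_, fun s => ?_⟩, W.smul_mem c hpa, fun w hw => ?_⟩, ?_⟩
    · exact (hp1 s).const_smul c
    · simpa using (hp2 s).const_smul c
    · have h1 := hpσ w hw
      simp only [Prod.smul_fst, Prod.smul_snd, Pi.smul_apply, real_inner_smul_left, map_smul,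
        LinearMap.smul_apply, smul_eq_mul] at *
      linear_combination c * h1
    · simp [Prod.smul_fst, Pi.smul_apply, hpt]

/-- The multiplicity `μ^P t` of the instant `t`: the dimension of the space of `P`-Jacobi
fields vanishing at `t` (which is `0` if `t` is not `P`-focal). -/
noncomputable def focalMultiplicity {n : ℕ}
    (S : ℝ → EuclideanSpace ℝ (Fin n) →L[ℝ] EuclideanSpace ℝ (Fin n))
    (σ : EuclideanSpace ℝ (Fin n) →ₗ[ℝ] EuclideanSpace ℝ (Fin n) →ₗ[ℝ] ℝ)
    (W : Submodule ℝ (EuclideanSpace ℝ (Fin n))) (a t : ℝ) : ℕ :=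
  Module.finrank ℝ (pJacobiVanishingAt S σ W a t)


section IndexOfForms

open Filter Topology Module

/-- Positive definiteness on a finite-dimensional space is stable under pointwise limits. -/
theorem eventually_pos_of_tendsto_bilin {M ι : Type*} [AddCommGroup M] [Module ℝ M]
    [FiniteDimensional ℝ M] {l : Filter ι} {B : ι → M →ₗ[ℝ] M →ₗ[ℝ] ℝ} {B₀ : M →ₗ[ℝ] M →ₗ[ℝ] ℝ}
    (h : ∀ x y, Tendsto (fun i => B i x y) l (𝓝 (B₀ x y))) (hpos : ∀ x ≠ 0, 0 < B₀ x x) :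
    ∀ᶠ i in l, ∀ x ≠ 0, 0 < B i x x := by
  classical
  let b := finBasis ℝ M
  let f := b.equivFun.symm
  have expand : ∀ (C : M →ₗ[ℝ] M →ₗ[ℝ] ℝ) (c : Fin (finrank ℝ M) → ℝ),
      C (f c) (f c) = ∑ j, ∑ k, c j * c k * C (b j) (b k) := by
    intro C c
    simp only [f, Basis.equivFun_symm_apply, map_sum, LinearMap.sum_apply, map_smul,
      LinearMap.smul_apply, smul_eq_mul, Finset.mul_sum]
    rw [Finset.sum_comm]
    refine Finset.sum_congr rfl fun j _ => Finset.sum_congr rfl fun k _ => by ring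
  have hcont : Continuous fun c : Fin (finrank ℝ M) → ℝ => B₀ (f c) (f c) := by
    simp only [expand]
    fun_prop
  obtain ⟨m, hm, hmle⟩ : ∃ m > 0, ∀ c : Fin (finrank ℝ M) → ℝ, ‖c‖ = 1 → m ≤ B₀ (f c) (f c) := by
    rcases (Metric.sphere (0 : Fin (finrank ℝ M) → ℝ) 1).eq_empty_or_nonempty with he | hne
    · refine ⟨1, one_pos, fun c hc => absurd (he ▸ mem_sphere_zero_iff_norm.2 hc) (notMem_empty c)⟩
    · obtain ⟨c, hc, hmin⟩ := (isCompact_sphere _ _).exists_isMinOn hne hcont.continuousOn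
      refine ⟨B₀ (f c) (f c), hpos _ fun h0 => ?_, fun c' hc' =>
        hmin (mem_sphere_zero_iff_norm.2 hc')⟩
      have : c = 0 := by simpa using h0
      simp [this] at hc
  have hsum : Tendsto (fun i => ∑ j, ∑ k, |B i (b j) (b k) - B₀ (b j) (b k)|) l (𝓝 0) := by
    have : Tendsto (fun i => ∑ j, ∑ k, |B i (b j) (b k) - B₀ (b j) (b k)|) l
        (𝓝 (∑ j, ∑ k, |B₀ (b j) (b k) - B₀ (b j) (b k)|)) :=
      tendsto_finsetSum _ fun j _ => tendsto_finsetSum _ fun k _ =>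
        ((h (b j) (b k)).sub_const _).abs
    simpa using this
  filter_upwards [hsum.eventually (gt_mem_nhds hm)] with i hi x hx
  have unit : ∀ c : Fin (finrank ℝ M) → ℝ, ‖c‖ = 1 → 0 < B i (f c) (f c) := by
    intro c hc
    have habs : |B i (f c) (f c) - B₀ (f c) (f c)| < m := by
      refine lt_of_le_of_lt ?_ hi
      rw [expand, expand, ← Finset.sum_sub_distrib]
      refine (Finset.abs_sum_le_sum_abs _ _).trans (Finset.sum_le_sum fun j _ => ?_)
      rw [← Finset.sum_sub_distrib]
      refine (Finset.abs_sum_le_sum_abs _ _).trans (Finset.sum_le_sum fun k _ => ?_)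
      rw [← mul_sub, abs_mul, abs_mul]
      have hj : |c j| ≤ 1 := hc ▸ norm_le_pi_norm c j
      have hk : |c k| ≤ 1 := hc ▸ norm_le_pi_norm c k
      exact mul_le_of_le_one_left (abs_nonneg _) (mul_le_one₀ hj (abs_nonneg _) hk)
    have := (abs_lt.1 habs).1
    linarith [hmle c hc]
  have hc0 : f.symm x ≠ 0 := by simpa using hx
  have hn : 0 < ‖f.symm x‖ := norm_pos_iff.2 hc0
  have := unit (‖f.symm x‖⁻¹ • f.symm x) (by rw [norm_smul, norm_inv, norm_norm]; field_simp)
  rw [map_smul, LinearEquiv.apply_symm_apply, map_smul, map_smul, LinearMap.smul_apply,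
    smul_eq_mul, smul_eq_mul] at this
  have h2 : 0 < ‖f.symm x‖⁻¹ := inv_pos.2 hn
  exact (mul_pos_iff_of_pos_left h2).1 ((mul_pos_iff_of_pos_left h2).1 this)

/-- Negative definiteness on a finite-dimensional space is stable under pointwise limits. -/
theorem eventually_neg_of_tendsto_bilin {M ι : Type*} [AddCommGroup M] [Module ℝ M]
    [FiniteDimensional ℝ M] {l : Filter ι} {B : ι → M →ₗ[ℝ] M →ₗ[ℝ] ℝ} {B₀ : M →ₗ[ℝ] M →ₗ[ℝ] ℝ}
    (h : ∀ x y, Tendsto (fun i => B i x y) l (𝓝 (B₀ x y))) (hneg : ∀ x ≠ 0, B₀ x x < 0) :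
    ∀ᶠ i in l, ∀ x ≠ 0, B i x x < 0 := by
  have := eventually_pos_of_tendsto_bilin (B := fun i => -B i) (B₀ := -B₀) (l := l)
    (fun x y => by simpa using (h x y).neg) (fun x hx => by simpa using hneg x hx)
  simpa using this

theorem finrank_le_indexOn {X M : Type*} [AddCommGroup X] [Module ℝ X] [AddCommGroup M]
    [Module ℝ M] [FiniteDimensional ℝ M] {B : X → X → ℝ} {K : Set X} (hB : B 0 0 = 0)
    (T : M →ₗ[ℝ] X) (hT : ∀ m, T m ∈ K) (hneg : ∀ m ≠ 0, B (T m) (T m) < 0) :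
    (finrank ℝ M : ℕ∞) ≤ indexOn B K := by
  have hinj : Function.Injective T := by
    rw [injective_iff_map_eq_zero]
    intro m hm
    by_contra hne
    have := hneg m hne
    rw [hm, hB] at this
    exact lt_irrefl _ this
  rw [← LinearMap.finrank_range_of_inj hinj]
  refine le_iSup₂_of_le (LinearMap.range T) ⟨?_, inferInstance, ?_⟩ le_rfl
  · rintro _ ⟨m, rfl⟩
    exact hT m
  · rintro _ ⟨m, rfl⟩ hne
    exact hneg m fun h0 => hne (by rw [h0, map_zero])

theorem indexOn_add_le {X : Type*} [AddCommGroup X] [Module ℝ X] {B : X → X → ℝ} {K : Set X}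
    (h0 : (0 : X) ∈ K) {m : ℕ} {k : ℕ∞}
    (h : ∀ U : Submodule ℝ X, (U : Set X) ⊆ K → FiniteDimensional ℝ U →
      (∀ v ∈ U, v ≠ 0 → B v v < 0) → (finrank ℝ U : ℕ∞) + m ≤ k) :
    indexOn B K + m ≤ k := by
  have hm : (m : ℕ∞) ≤ k := by
    have := h ⊥ (by simpa using h0) inferInstance (by simp)
    simpa using this
  have : indexOn B K ≤ k - m :=
    iSup₂_le fun U hU =>
      ENat.le_sub_of_add_le_right (ENat.natCast_ne_top m) (h U hU.1 hU.2.1 hU.2.2)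
  calc indexOn B K + m ≤ (k - m) + m := by gcongr
    _ = k := tsub_add_cancel_of_le hm

theorem exists_finrank_eq_indexOn {M : Type*} [AddCommGroup M] [Module ℝ M]
    [FiniteDimensional ℝ M] (B : M → M → ℝ) :
    ∃ U : Submodule ℝ M, (∀ v ∈ U, v ≠ 0 → B v v < 0) ∧
      (finrank ℝ U : ℕ∞) = indexOn B univ := by
  let s : Set ℕ := {d | ∃ U : Submodule ℝ M, (∀ v ∈ U, v ≠ 0 → B v v < 0) ∧ finrank ℝ U = d}
  have hne : s.Nonempty := ⟨0, ⊥, by simp, by simp⟩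
  have hbdd : BddAbove s := ⟨finrank ℝ M, by
    rintro _ ⟨U, -, rfl⟩
    exact U.finrank_le⟩
  obtain ⟨U, hU, hd⟩ := Nat.sSup_mem hne hbdd
  refine ⟨U, hU, le_antisymm (le_iSup₂_of_le U ⟨subset_univ _, inferInstance, hU⟩ le_rfl)
    (iSup₂_le fun U' hU' => ?_)⟩
  rw [hd]
  exact_mod_cast le_csSup hbdd ⟨U', hU'.2.2, rfl⟩

/-- Complementary to the index and the kernel there is a positive definite subspace. -/
theorem exists_pos_submodule {M : Type*} [AddCommGroup M] [Module ℝ M]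
    [FiniteDimensional ℝ M] (B : M →ₗ[ℝ] M →ₗ[ℝ] ℝ) (hB : ∀ x y, B x y = B y x) :
    ∃ P : Submodule ℝ M, (∀ v ∈ P, v ≠ 0 → 0 < B v v) ∧
      (finrank ℝ M : ℕ∞) ≤ indexOn (fun x y => B x y) univ + finrank ℝ (LinearMap.ker B) +
        finrank ℝ P := by
  obtain ⟨U, hU, hd⟩ := exists_finrank_eq_indexOn (fun x y => B x y)
  let φ : M →ₗ[ℝ] (U →ₗ[ℝ] ℝ) := B.compl₂ U.subtype
  have hφ : ∀ x (u : U), φ x u = B x u := fun x u => rfl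
  have hnonneg : ∀ x ∈ LinearMap.ker φ, 0 ≤ B x x := by
    intro x hx
    by_contra! hlt
    have key : (finrank ℝ (U × ℝ) : ℕ∞) ≤ indexOn (fun x y => B x y) univ := by
      refine finrank_le_indexOn (by simp)
        (U.subtype.coprod (LinearMap.toSpanSingleton ℝ M x)) (fun _ => mem_univ _) ?_
      rintro ⟨u, r⟩ hne
      have h1 : B x u = 0 := by rw [← hφ, LinearMap.mem_ker.1 hx]; rfl
      have h2 : B u x = 0 := by rw [hB, h1]
      simp only [LinearMap.coprod_apply, Submodule.subtype_apply,
        LinearMap.toSpanSingleton_apply, map_add, LinearMap.add_apply, map_smul,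
        LinearMap.smul_apply, smul_eq_mul, h1, h2]
      by_cases hu : u = 0
      · have hr : r ≠ 0 := fun h => hne (by rw [hu, h]; rfl)
        have := mul_pos_iff.2 (Or.inl ⟨mul_self_pos.2 hr, neg_pos.2 hlt⟩)
        simp only [hu, ZeroMemClass.coe_zero, map_zero]
        linarith
      · have := hU u u.2 (by simpa using hu)
        have h3 := mul_nonneg (mul_self_nonneg r) (neg_pos.2 hlt).le
        linarith
    rw [← hd, finrank_prod, finrank_self] at key
    have : finrank ℝ U + 1 ≤ finrank ℝ U := by exact_mod_cast key
    omega
  have hsplit : ∀ y : M, ∃ u : U, y - u ∈ LinearMap.ker φ := by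
    have hinj : Function.Injective (φ.comp U.subtype) := by
      rw [injective_iff_map_eq_zero]
      intro u hu
      by_contra hne
      have h1 := hU u u.2 (by simpa using hne)
      have h2 : φ u u = 0 := by
        have := LinearMap.congr_fun hu u
        simpa using this
      rw [hφ] at h2
      linarith
    have hsurj := (LinearMap.injective_iff_surjective_of_finrank_eq_finrank
      (f := φ.comp U.subtype) (Subspace.dual_finrank_eq (K := ℝ) (V := U)).symm).1 hinj
    intro y
    obtain ⟨u, hu⟩ := hsurj (φ y)
    exact ⟨u, by rw [LinearMap.mem_ker, map_sub, ← hu]; simp⟩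
  have hnull : ∀ x ∈ LinearMap.ker φ, B x x = 0 → x ∈ LinearMap.ker B := by
    intro x hx hxx
    have horth : ∀ y ∈ LinearMap.ker φ, B x y = 0 := by
      intro y hy
      by_contra hne
      have := hnonneg (y + (-(B y y + 1) / (2 * B x y)) • x)
        ((LinearMap.ker φ).add_mem hy ((LinearMap.ker φ).smul_mem _ hx))
      simp only [map_add, LinearMap.add_apply, map_smul, LinearMap.smul_apply, smul_eq_mul,
        hB y x, hxx] at this
      have h2 : -(B y y + 1) / (2 * B x y) * B x y = -(B y y + 1) / 2 := by field_simp
      rw [h2] at this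
      linarith
    rw [LinearMap.mem_ker]
    ext y
    obtain ⟨u, hu⟩ := hsplit y
    have h1 := horth _ hu
    have h2 : B x u = 0 := by rw [← hφ, LinearMap.mem_ker.1 hx]; rfl
    rw [map_sub, h2, sub_zero] at h1
    simpa using h1
  let Z : Submodule ℝ (LinearMap.ker φ) := (LinearMap.ker B).comap (LinearMap.ker φ).subtype
  obtain ⟨P, hP⟩ := Z.exists_isCompl
  refine ⟨P.map (LinearMap.ker φ).subtype, ?_, ?_⟩
  · rintro _ ⟨⟨v, hv⟩, hvP, rfl⟩ hne
    refine lt_of_le_of_ne (hnonneg v hv) fun h0 => hne ?_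
    have hz : (⟨v, hv⟩ : LinearMap.ker φ) ∈ Z := hnull v hv h0.symm
    have := hP.disjoint.le_bot ⟨hz, hvP⟩
    simpa using this
  · have h1 := LinearMap.finrank_range_add_finrank_ker φ
    have h2 : finrank ℝ (LinearMap.range φ) ≤ finrank ℝ U :=
      (LinearMap.range φ).finrank_le.trans (Subspace.dual_finrank_eq (K := ℝ) (V := U)).le
    have h3 := Submodule.finrank_add_eq_of_isCompl hP
    have h4 : finrank ℝ Z ≤ finrank ℝ (LinearMap.ker B) := by
      have : finrank ℝ (Z.map (LinearMap.ker φ).subtype) = finrank ℝ Z :=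
        Submodule.finrank_map_subtype_eq _ _
      rw [← this]
      exact Submodule.finrank_mono (Submodule.map_comap_le _ _)
    have h5 : finrank ℝ (P.map (LinearMap.ker φ).subtype) = finrank ℝ P :=
      Submodule.finrank_map_subtype_eq _ _
    rw [← hd, h5]
    norm_cast
    omega

/-- Semicontinuity of the index of symmetric bilinear forms in finite dimension. -/
theorem eventually_indexOn_le {M ι : Type*} [AddCommGroup M] [Module ℝ M]
    [FiniteDimensional ℝ M] {l : Filter ι} {B : ι → M →ₗ[ℝ] M →ₗ[ℝ] ℝ} {B₀ : M →ₗ[ℝ] M →ₗ[ℝ] ℝ}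
    (h : ∀ x y, Tendsto (fun i => B i x y) l (𝓝 (B₀ x y))) (hB : ∀ x y, B₀ x y = B₀ y x) :
    ∀ᶠ i in l, indexOn (fun x y => B₀ x y) univ ≤ indexOn (fun x y => B i x y) univ ∧
      indexOn (fun x y => B i x y) univ ≤
        indexOn (fun x y => B₀ x y) univ + finrank ℝ (LinearMap.ker B₀) := by
  obtain ⟨U, hU, hd⟩ := exists_finrank_eq_indexOn (fun x y => B₀ x y)
  obtain ⟨P, hP, hle⟩ := exists_pos_submodule B₀ hB
  have hUev := eventually_neg_of_tendsto_bilin (l := l)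
    (B := fun i => (B i).compl₁₂ U.subtype U.subtype) (B₀ := B₀.compl₁₂ U.subtype U.subtype)
    (fun x y => h x y) (fun x hx => hU x x.2 (by simpa using hx))
  have hPev := eventually_pos_of_tendsto_bilin (l := l)
    (B := fun i => (B i).compl₁₂ P.subtype P.subtype) (B₀ := B₀.compl₁₂ P.subtype P.subtype)
    (fun x y => h x y) (fun x hx => hP x x.2 (by simpa using hx))
  filter_upwards [hUev, hPev] with i hiU hiP
  constructor
  · rw [← hd]
    exact finrank_le_indexOn (by simp) U.subtype (fun _ => mem_univ _) hiU
  · refine iSup₂_le fun N hN => ?_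
    have hdisj : Disjoint N P := by
      rw [Submodule.disjoint_def]
      intro x hxN hxP
      by_contra hne
      have h1 := hN.2.2 x hxN hne
      have h2 : 0 < B i x x := hiP ⟨x, hxP⟩ (by simpa using hne)
      linarith
    have h3 := Submodule.finrank_add_finrank_le_of_disjoint hdisj
    rw [← hd] at hle ⊢
    norm_cast at hle ⊢
    omega

end IndexOfForms

section LinearODE

open Filter Topology

variable {F : Type*} [NormedAddCommGroup F] [NormedSpace ℝ F]

/-- The terms of the Picard (Peano–Baker) series of the linear equation `x' = L x`, `x c = v`. -/
noncomputable def linearPicardTerm (L : ℝ → F →L[ℝ] F) (c : ℝ) (v : F) : ℕ → ℝ → F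
  | 0 => fun _ => v
  | k + 1 => fun t => ∫ s in c..t, L s (linearPicardTerm L c v k s)

theorem hasDerivAt_linearPicardTerm_succ [CompleteSpace F] {L : ℝ → F →L[ℝ] F}
    (hL : Continuous L) (c : ℝ) (v : F) (k : ℕ) (t : ℝ) :
    HasDerivAt (linearPicardTerm L c v (k + 1)) (L t (linearPicardTerm L c v k t)) t := by
  have hcont : Continuous (linearPicardTerm L c v k) := by
    induction k with
    | zero => exact continuous_const
    | succ k ih =>
      exact intervalIntegral.continuous_primitive
        (fun _ _ => (hL.clm_apply ih).intervalIntegrable _ _) c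
  exact ((hL.clm_apply hcont).integral_hasStrictDerivAt c t).hasDerivAt

theorem norm_linearPicardTerm_le {L : ℝ → F →L[ℝ] F} {c T M : ℝ}
    (hM : ∀ s, |s - c| ≤ T → ‖L s‖ ≤ M) (hM0 : 0 ≤ M) (v : F) (k : ℕ) {t : ℝ}
    (ht : |t - c| ≤ T) :
    ‖linearPicardTerm L c v k t‖ ≤ ‖v‖ * ((M * |t - c|) ^ k / k.factorial) := by
  induction k generalizing t with
  | zero => simp [linearPicardTerm]
  | succ k ih =>
    have hle : ∀ s ∈ Set.uIoc c t, ‖L s (linearPicardTerm L c v k s)‖ ≤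
        ‖v‖ * M ^ (k + 1) / k.factorial * |s - c| ^ k := by
      intro s hs
      have hs' : |s - c| ≤ |t - c| := abs_sub_left_of_mem_uIcc (Set.uIoc_subset_uIcc hs)
      have hsT := hs'.trans ht
      calc ‖L s (linearPicardTerm L c v k s)‖
          ≤ M * (‖v‖ * ((M * |s - c|) ^ k / k.factorial)) :=
            (L s).le_of_opNorm_le_of_le (hM s hsT) (ih hsT)
        _ = _ := by rw [mul_pow]; ring
    calc ‖linearPicardTerm L c v (k + 1) t‖
        ≤ |∫ s in c..t, ‖v‖ * M ^ (k + 1) / k.factorial * |s - c| ^ k| :=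
          intervalIntegral.norm_integral_le_abs_of_norm_le
            (MeasureTheory.ae_restrict_of_forall_mem measurableSet_uIoc hle)
            (Continuous.intervalIntegrable (by fun_prop) _ _)
      _ = ‖v‖ * M ^ (k + 1) / k.factorial * (|t - c| ^ (k + 1) / (k + 1)) := by
          rw [intervalIntegral.abs_integral_eq_abs_integral_uIoc,
            MeasureTheory.integral_const_mul, integral_pow_abs_sub_uIoc, abs_of_nonneg]
          positivity
      _ = _ := by
          rw [mul_pow, Nat.factorial_succ]
          push_cast
          field_simp

/-- Global existence for linear ordinary differential equations. -/
theorem exists_hasDerivAt_linear [CompleteSpace F] {L : ℝ → F →L[ℝ] F} (hL : Continuous L)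
    (c : ℝ) (v : F) : ∃ x : ℝ → F, x c = v ∧ ∀ t, HasDerivAt x (L t (x t)) t := by
  let g := linearPicardTerm L c v
  let g' : ℕ → ℝ → F := fun k t => Nat.casesOn k 0 fun j => L t (g j t)
  have hg : ∀ k t, HasDerivAt (g k) (g' k t) t := by
    intro k t
    cases k with
    | zero => exact hasDerivAt_const t v
    | succ k => exact hasDerivAt_linearPicardTerm_succ hL c v k t
  refine ⟨fun t => ∑' k, g k t, ?_, fun t => ?_⟩
  · change ∑' k, g k c = v
    rw [tsum_eq_single 0]
    · rfl
    · intro k hk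
      obtain ⟨j, rfl⟩ := Nat.exists_eq_succ_of_ne_zero hk
      simp [g, linearPicardTerm]
  · let T := |t - c| + 1
    obtain ⟨M', hM'⟩ := (isCompact_Icc (a := c - T) (b := c + T)).exists_bound_of_continuousOn
      hL.continuousOn
    let M := max M' 0
    have hM : ∀ s, |s - c| ≤ T → ‖L s‖ ≤ M := fun s hs =>
      (hM' s (by rw [abs_le] at hs; constructor <;> linarith)).trans (le_max_left _ _)
    have hM0 : 0 ≤ M := le_max_right _ _
    have hT : 0 ≤ T := by positivity
    have hbound : ∀ k s, |s - c| ≤ T → ‖g k s‖ ≤ ‖v‖ * ((M * T) ^ k / k.factorial) := by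
      intro k s hs
      refine (norm_linearPicardTerm_le hM hM0 v k hs).trans ?_
      gcongr
    have hsum : Summable fun k : ℕ => ‖v‖ * ((M * T) ^ k / k.factorial) :=
      (Real.summable_pow_div_factorial _).mul_left _
    let u : ℕ → ℝ := fun k => Nat.casesOn k 0 fun j => M * (‖v‖ * ((M * T) ^ j / j.factorial))
    have hu : Summable u := (summable_nat_add_iff 1).1 (hsum.mul_left M)
    have hgu : ∀ k, ∀ s ∈ Ioo (c - T) (c + T), ‖g' k s‖ ≤ u k := by
      intro k s hs
      have hs' : |s - c| ≤ T := abs_le.2 ⟨by linarith [hs.1], by linarith [hs.2]⟩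
      cases k with
      | zero => simp [g', u]
      | succ k => exact (L s).le_of_opNorm_le_of_le (hM s hs') (hbound k s hs')
    have htT : |t - c| ≤ T := by simp [T]
    have htmem : t ∈ Ioo (c - T) (c + T) := by
      have : |t - c| < T := by simp [T]
      rw [abs_lt] at this
      constructor <;> linarith
    have hsumt : Summable fun k => g k t := .of_norm_bounded hsum fun k => hbound k t htT
    have := hasDerivAt_tsum_of_isPreconnected hu isOpen_Ioo isPreconnected_Ioo
      (fun k s _ => hg k s) hgu htmem hsumt htmem
    convert this using 1
    have hsum' : Summable fun k => g' k t := .of_norm_bounded hu fun k => hgu k t htmem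
    rw [hsum'.tsum_eq_zero_add, (L t).map_tsum hsumt]
    simp [g']

/-- Uniqueness for linear ordinary differential equations. -/
theorem eq_of_hasDerivAt_linear {L : ℝ → F →L[ℝ] F} (hL : Continuous L) {c : ℝ} {x y : ℝ → F}
    (hx : ∀ t, HasDerivAt x (L t (x t)) t) (hy : ∀ t, HasDerivAt y (L t (y t)) t)
    (h : x c = y c) : x = y := by
  ext t
  let T := |t - c| + 1
  obtain ⟨M, hM⟩ := (isCompact_Icc (a := c - T) (b := c + T)).exists_bound_of_continuousOn
    hL.continuousOn
  have hT : 0 < T := by positivity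
  have htmem : t ∈ Ioo (c - T) (c + T) := by
    have : |t - c| < T := by simp [T]
    rw [abs_lt] at this
    constructor <;> linarith
  refine ODE_solution_unique_of_mem_Ioo (v := fun s => L s) (s := fun _ => univ)
    (K := M.toNNReal) (t₀ := c) (fun s hs => ?_) ⟨by linarith, by linarith⟩
    (fun s _ => ⟨hx s, mem_univ _⟩) (fun s _ => ⟨hy s, mem_univ _⟩) h htmem
  refine ((L s).lipschitz.weaken ?_).lipschitzOnWith
  rw [← norm_toNNReal]
  exact Real.toNNReal_le_toNNReal (hM s (Ioo_subset_Icc_self hs))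

end LinearODE

section JacobiFields

open Module

variable {n : ℕ} {S : ℝ → EuclideanSpace ℝ (Fin n) →L[ℝ] EuclideanSpace ℝ (Fin n)}

/-- The Jacobi equation as a first order linear system. -/
noncomputable def jacobiSystem
    (S : ℝ → EuclideanSpace ℝ (Fin n) →L[ℝ] EuclideanSpace ℝ (Fin n)) (t : ℝ) :
    EuclideanSpace ℝ (Fin n) × EuclideanSpace ℝ (Fin n) →L[ℝ]
      EuclideanSpace ℝ (Fin n) × EuclideanSpace ℝ (Fin n) :=
  (ContinuousLinearMap.snd ℝ _ _).prod ((S t).comp (ContinuousLinearMap.fst ℝ _ _))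

theorem continuous_jacobiSystem (hS : Continuous S) : Continuous (jacobiSystem S) := by
  refine continuous_clm_apply.2 fun x => ?_
  exact continuous_const.prodMk (hS.clm_apply continuous_const)

theorem IsJacobiPair.hasDerivAt_prodMk {J J' : ℝ → EuclideanSpace ℝ (Fin n)}
    (h : IsJacobiPair S J J') (t : ℝ) :
    HasDerivAt (fun s => (J s, J' s)) (jacobiSystem S t (J t, J' t)) t :=
  (h.1 t).prodMk (h.2 t)

/-- The space of Jacobi fields, encoded as pairs `(J, J')`. -/
def jacobiFields (S : ℝ → EuclideanSpace ℝ (Fin n) →L[ℝ] EuclideanSpace ℝ (Fin n)) :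
    Submodule ℝ ((ℝ → EuclideanSpace ℝ (Fin n)) × (ℝ → EuclideanSpace ℝ (Fin n))) where
  carrier := {p | IsJacobiPair S p.1 p.2}
  zero_mem' := ⟨fun s => hasDerivAt_const s 0, fun s => by simp⟩
  add_mem' hp hq := ⟨fun s => (hp.1 s).add (hq.1 s), fun s => by
    simpa using (hp.2 s).add (hq.2 s)⟩
  smul_mem' c p hp := ⟨fun s => (hp.1 s).const_smul c, fun s => by
    simpa using (hp.2 s).const_smul c⟩

/-- The Cauchy data of a Jacobi field at an instant. -/
def jacobiCauchy (S : ℝ → EuclideanSpace ℝ (Fin n) →L[ℝ] EuclideanSpace ℝ (Fin n)) (c : ℝ) :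
    jacobiFields S →ₗ[ℝ] EuclideanSpace ℝ (Fin n) × EuclideanSpace ℝ (Fin n) where
  toFun p := (p.1.1 c, p.1.2 c)
  map_add' _ _ := rfl
  map_smul' _ _ := rfl

theorem jacobiCauchy_injective (hS : Continuous S) (c : ℝ) :
    Function.Injective (jacobiCauchy S c) := by
  intro p q h
  have := eq_of_hasDerivAt_linear (continuous_jacobiSystem hS) (c := c)
    p.2.hasDerivAt_prodMk q.2.hasDerivAt_prodMk h
  exact Subtype.ext (Prod.ext (funext fun t => congrArg Prod.fst (congrFun this t))
    (funext fun t => congrArg Prod.snd (congrFun this t)))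

theorem jacobiCauchy_surjective (hS : Continuous S) (c : ℝ) :
    Function.Surjective (jacobiCauchy S c) := by
  intro v
  obtain ⟨x, hxc, hx⟩ := exists_hasDerivAt_linear (continuous_jacobiSystem hS) c v
  exact ⟨⟨(fun t => (x t).1, fun t => (x t).2), fun t => (hx t).fst, fun t => (hx t).snd⟩, hxc⟩

theorem finiteDimensional_jacobiFields (hS : Continuous S) :
    FiniteDimensional ℝ (jacobiFields S) :=
  FiniteDimensional.of_injective _ (jacobiCauchy_injective hS 0)

theorem finrank_jacobiFields (hS : Continuous S) :
    finrank ℝ (jacobiFields S) =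
      finrank ℝ (EuclideanSpace ℝ (Fin n) × EuclideanSpace ℝ (Fin n)) :=
  (LinearEquiv.ofBijective _
    ⟨jacobiCauchy_injective hS 0, jacobiCauchy_surjective hS 0⟩).finrank_eq

theorem finiteDimensional_pJacobiVanishingAt (hS : Continuous S)
    (σ : EuclideanSpace ℝ (Fin n) →ₗ[ℝ] EuclideanSpace ℝ (Fin n) →ₗ[ℝ] ℝ)
    (W : Submodule ℝ (EuclideanSpace ℝ (Fin n))) (a t : ℝ) :
    FiniteDimensional ℝ (pJacobiVanishingAt S σ W a t) :=
  have := finiteDimensional_jacobiFields hS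
  Submodule.finiteDimensional_of_le (S₂ := jacobiFields S) fun _ hp => hp.1.1

/-- Jacobi fields agreeing on a nondegenerate interval coincide. -/
theorem jacobiFields_eq_of_eqOn (hS : Continuous S) {p q : ℝ} (hpq : p < q)
    {J K : jacobiFields S} (h : ∀ x ∈ Icc p q, J.1.1 x = K.1.1 x) : J = K := by
  have hm : (p + q) / 2 ∈ Ioo p q := ⟨by linarith, by linarith⟩
  refine jacobiCauchy_injective hS ((p + q) / 2) (Prod.ext (h _ (Ioo_subset_Icc_self hm)) ?_)
  refine (J.2.1 _).unique ((K.2.1 _).congr_of_eventuallyEq ?_)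
  filter_upwards [Ioo_mem_nhds hm.1 hm.2] with x hx using h x (Ioo_subset_Icc_self hx)

end JacobiFields

section PiecewiseC1

/-- A point between the first and the last value of a finite sequence lies between two consecutive
values. -/
theorem exists_castSucc_le_lt_succ {k : ℕ} {s : Fin (k + 1) → ℝ} {x : ℝ} (h0 : s 0 ≤ x)
    (h1 : x < s (Fin.last k)) : ∃ i : Fin k, s i.castSucc ≤ x ∧ x < s i.succ := by
  have key : ∀ j : Fin (k + 1), x < s j → ∃ i : Fin k, s i.castSucc ≤ x ∧ x < s i.succ := by
    intro j
    induction j using Fin.induction with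
    | zero => exact fun hj => absurd hj h0.not_gt
    | succ i ih =>
      intro hj
      by_cases hi : x < s i.castSucc
      · exact ih hi
      · exact ⟨i, not_lt.1 hi, hj⟩
  exact key _ h1

variable {F : Type*} [NormedAddCommGroup F] [NormedSpace ℝ F] {a b c : ℝ} {V U : ℝ → F}

namespace PiecewiseC1On

theorem le (h : PiecewiseC1On a b V) : a ≤ b := by
  obtain ⟨-, k, s, h0, h1, hs, -⟩ := h
  rw [← h0, ← h1]
  exact hs.monotone (Fin.zero_le _)

/-- A piecewise `C¹` map is `C¹` on the closed intervals whose interior avoids a finite set. -/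
theorem exists_finset (h : PiecewiseC1On a b V) :
    ∃ C : Finset ℝ, ∀ p q, a ≤ p → p < q → q ≤ b → (∀ x ∈ C, x ∉ Ioo p q) →
      ContDiffOn ℝ 1 V (Icc p q) := by
  classical
  obtain ⟨-, k, s, h0, h1, hs, hV⟩ := h
  refine ⟨Finset.univ.image s, fun p q hap hpq hqb hC => ?_⟩
  obtain ⟨i, hi1, hi2⟩ := exists_castSucc_le_lt_succ (h0.trans_le hap) (h1 ▸ hpq.trans_le hqb)
  refine (hV i).mono (Icc_subset_Icc hi1 ?_)
  by_contra! hlt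
  exact hC (s i.succ) (Finset.mem_image_of_mem s (Finset.mem_univ _)) ⟨hi2, hlt⟩

theorem of_finset (hab : a ≤ b) (hc : ContinuousOn V (Icc a b)) (C : Finset ℝ)
    (hC : ∀ p q, a ≤ p → p < q → q ≤ b → (∀ x ∈ C, x ∉ Ioo p q) →
      ContDiffOn ℝ 1 V (Icc p q)) : PiecewiseC1On a b V := by
  classical
  let D : Finset ℝ := insert a (insert b (C.filter (· ∈ Icc a b)))
  have hD : ∀ x ∈ D, x ∈ Icc a b := by
    intro x hx
    simp only [D, Finset.mem_insert, Finset.mem_filter] at hx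
    rcases hx with rfl | rfl | hx
    · exact left_mem_Icc.2 hab
    · exact right_mem_Icc.2 hab
    · exact hx.2
  have haD : a ∈ D := by simp [D]
  have hbD : b ∈ D := by simp [D]
  obtain ⟨k, hk⟩ : ∃ k, D.card = k + 1 :=
    Nat.exists_eq_succ_of_ne_zero (Finset.card_ne_zero_of_mem haD)
  let s := D.orderEmbOfFin hk
  have hsr : ∀ x ∈ D, ∃ j, s j = x := by
    intro x hx
    have : x ∈ Set.range s := by rw [D.range_orderEmbOfFin hk]; exact hx
    exact this
  have hsD : ∀ j, s j ∈ Icc a b := fun j => hD _ (D.orderEmbOfFin_mem hk j)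
  refine ⟨hc, k, s, ?_, ?_, s.strictMono, fun i => ?_⟩
  · obtain ⟨j, hj⟩ := hsr a haD
    exact le_antisymm (hj ▸ s.monotone (Fin.zero_le j)) (hsD 0).1
  · obtain ⟨j, hj⟩ := hsr b hbD
    exact le_antisymm (hsD _).2 (hj ▸ s.monotone (Fin.le_last j))
  · refine hC _ _ (hsD _).1 (s.strictMono Fin.castSucc_lt_succ) (hsD _).2 fun x hx hxI => ?_
    obtain ⟨j, rfl⟩ := hsr x (by
      simp only [D, Finset.mem_insert, Finset.mem_filter]
      exact Or.inr (Or.inr ⟨hx, (hsD _).1.trans hxI.1.le, hxI.2.le.trans (hsD _).2⟩))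
    have h1 := s.lt_iff_lt.1 hxI.1
    have h2 := s.lt_iff_lt.1 hxI.2
    rw [Fin.lt_def] at h1 h2
    simp only [Fin.val_castSucc, Fin.val_succ] at h1 h2
    omega

theorem mono (h : PiecewiseC1On a b V) {a' b' : ℝ} (ha : a ≤ a') (hab : a' ≤ b') (hb : b' ≤ b) :
    PiecewiseC1On a' b' V := by
  obtain ⟨C, hC⟩ := h.exists_finset
  exact .of_finset hab (h.1.mono (Icc_subset_Icc ha hb)) C fun p q hp hpq hq =>
    hC p q (ha.trans hp) hpq (hq.trans hb)

theorem of_contDiff (hab : a ≤ b) (h : ContDiff ℝ 1 V) : PiecewiseC1On a b V :=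
  .of_finset hab h.continuous.continuousOn ∅ fun _ _ _ _ _ _ => h.contDiffOn

theorem congr (h : PiecewiseC1On a b V) (hU : EqOn U V (Icc a b)) : PiecewiseC1On a b U := by
  obtain ⟨C, hC⟩ := h.exists_finset
  exact .of_finset h.le (h.1.congr hU) C fun p q hp hpq hq hx =>
    (hC p q hp hpq hq hx).congr (hU.mono (Icc_subset_Icc hp hq))

theorem add (hV : PiecewiseC1On a b V) (hU : PiecewiseC1On a b U) :
    PiecewiseC1On a b (V + U) := by
  classical
  obtain ⟨C, hC⟩ := hV.exists_finset
  obtain ⟨D, hD⟩ := hU.exists_finset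
  exact .of_finset hV.le (hV.1.add hU.1) (C ∪ D) fun p q hp hpq hq hx =>
    (hC p q hp hpq hq fun x hxC => hx x (Finset.mem_union_left _ hxC)).add
      (hD p q hp hpq hq fun x hxD => hx x (Finset.mem_union_right _ hxD))

theorem const_smul (hV : PiecewiseC1On a b V) (r : ℝ) : PiecewiseC1On a b (r • V) := by
  obtain ⟨C, hC⟩ := hV.exists_finset
  exact .of_finset hV.le (hV.1.const_smul r) C fun p q hp hpq hq hx =>
    (hC p q hp hpq hq hx).const_smul r

theorem sub (hV : PiecewiseC1On a b V) (hU : PiecewiseC1On a b U) :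
    PiecewiseC1On a b (V - U) := by
  have := hV.add (hU.const_smul (-1))
  rwa [neg_one_smul, ← sub_eq_add_neg] at this

theorem trans (hV : PiecewiseC1On a c V) (hU : PiecewiseC1On c b V) : PiecewiseC1On a b V := by
  classical
  obtain ⟨C, hC⟩ := hV.exists_finset
  obtain ⟨D, hD⟩ := hU.exists_finset
  refine .of_finset (hV.le.trans hU.le) ?_ (insert c (C ∪ D)) fun p q hp hpq hq hx => ?_
  · rw [← Icc_union_Icc_eq_Icc hV.le hU.le]
    exact hV.1.union_of_isClosed hU.1 isClosed_Icc isClosed_Icc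
  · have hc := hx c (Finset.mem_insert_self _ _)
    rcases le_or_gt q c with hqc | hcq
    · exact hC p q hp hpq hqc fun x hxC =>
        hx x (Finset.mem_insert_of_mem (Finset.mem_union_left _ hxC))
    · have hcp : c ≤ p := by
        by_contra! hlt
        exact hc ⟨hlt, hcq⟩
      exact hD p q hcp hpq hq fun x hxD =>
        hx x (Finset.mem_insert_of_mem (Finset.mem_union_right _ hxD))

/-- Away from a finite set, a piecewise `C¹` map is differentiable with bounded derivative. -/
theorem exists_deriv_bound (h : PiecewiseC1On a b V) :
    ∃ (C : Set ℝ) (B : ℝ), C.Countable ∧ ∀ x ∈ Ioo a b \ C,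
      DifferentiableAt ℝ V x ∧ ‖deriv V x‖ ≤ B := by
  obtain ⟨-, k, s, h0, h1, hs, hV⟩ := h
  have hb : ∀ i : Fin k, ∃ B, ∀ x ∈ Ioo (s i.castSucc) (s i.succ),
      DifferentiableAt ℝ V x ∧ ‖deriv V x‖ ≤ B := by
    intro i
    have hlt : s i.castSucc < s i.succ := hs Fin.castSucc_lt_succ
    obtain ⟨B, hB⟩ := isCompact_Icc.exists_bound_of_continuousOn
      ((hV i).continuousOn_derivWithin (uniqueDiffOn_Icc hlt) le_rfl)
    refine ⟨B, fun x hx => ?_⟩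
    have hnhds := Icc_mem_nhds hx.1 hx.2
    refine ⟨((hV i).differentiableOn one_ne_zero).differentiableAt hnhds, ?_⟩
    rw [← derivWithin_of_mem_nhds hnhds]
    exact hB x (Ioo_subset_Icc_self hx)
  choose B hB using hb
  refine ⟨Set.range s, ∑ i, |B i|, Set.countable_range s, fun x hx => ?_⟩
  obtain ⟨i, hi1, hi2⟩ := exists_castSucc_le_lt_succ (h0.trans_le hx.1.1.le) (h1 ▸ hx.1.2)
  obtain ⟨hd, hn⟩ := hB i x
    ⟨lt_of_le_of_ne hi1 fun he => hx.2 ⟨_, he⟩, hi2⟩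
  exact ⟨hd, hn.trans ((le_abs_self _).trans
    (Finset.single_le_sum (f := fun i => |B i|) (fun _ _ => abs_nonneg _) (Finset.mem_univ i)))⟩

theorem ae_differentiableAt (h : PiecewiseC1On a b V) :
    ∀ᵐ x, x ∈ Set.uIoc a b → DifferentiableAt ℝ V x := by
  obtain ⟨C, B, hC, hd⟩ := h.exists_deriv_bound
  filter_upwards [hC.ae_notMem MeasureTheory.volume,
    MeasureTheory.Measure.ae_ne MeasureTheory.volume b] with x hxC hxb hx
  rw [uIoc_of_le h.le] at hx
  exact (hd x ⟨⟨hx.1, lt_of_le_of_ne hx.2 hxb⟩, hxC⟩).1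

end PiecewiseC1On

end PiecewiseC1

section EnergyForm

open MeasureTheory

variable {E : Type*} [NormedAddCommGroup E] [InnerProductSpace ℝ E] {p q r : ℝ}

theorem intervalIntegrable_inner_of_bounded {f g : ℝ → E} (hpq : p ≤ q)
    (hf : AEStronglyMeasurable f (volume.restrict (Ioc p q)) ∧
      ∃ B, ∀ᵐ x ∂volume.restrict (Ioc p q), ‖f x‖ ≤ B)
    (hg : AEStronglyMeasurable g (volume.restrict (Ioc p q)) ∧
      ∃ B, ∀ᵐ x ∂volume.restrict (Ioc p q), ‖g x‖ ≤ B) :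
    IntervalIntegrable (fun x => (inner ℝ (f x) (g x) : ℝ)) volume p q := by
  obtain ⟨hfm, B, hB⟩ := hf
  obtain ⟨hgm, C, hC⟩ := hg
  rw [intervalIntegrable_iff_integrableOn_Ioc_of_le hpq]
  refine Integrable.of_bound (hfm.inner hgm) (B * C) ?_
  filter_upwards [hB, hC] with x hx hx'
  exact (norm_inner_le_norm _ _).trans
    (mul_le_mul hx hx' (norm_nonneg _) ((norm_nonneg _).trans hx))

theorem ContinuousOn.bounded_Ioc {F : Type*} [NormedAddCommGroup F] {f : ℝ → F}
    (hf : ContinuousOn f (Icc p q)) :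
    AEStronglyMeasurable f (volume.restrict (Ioc p q)) ∧
      ∃ B, ∀ᵐ x ∂volume.restrict (Ioc p q), ‖f x‖ ≤ B := by
  obtain ⟨B, hB⟩ := isCompact_Icc.exists_bound_of_continuousOn hf
  exact ⟨(hf.mono Ioc_subset_Icc_self).aestronglyMeasurable measurableSet_Ioc, B,
    ae_restrict_of_forall_mem measurableSet_Ioc fun x hx => hB x (Ioc_subset_Icc_self hx)⟩

theorem PiecewiseC1On.bounded_deriv_Ioc [CompleteSpace E] {V : ℝ → E} (hV : PiecewiseC1On p q V) :
    AEStronglyMeasurable (deriv V) (volume.restrict (Ioc p q)) ∧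
      ∃ B, ∀ᵐ x ∂volume.restrict (Ioc p q), ‖deriv V x‖ ≤ B := by
  obtain ⟨C, B, hC, hd⟩ := hV.exists_deriv_bound
  refine ⟨aestronglyMeasurable_deriv V _, B, (ae_restrict_iff' measurableSet_Ioc).2 ?_⟩
  filter_upwards [hC.ae_notMem volume, Measure.ae_ne volume q] with x hxC hxq hx
  exact (hd x ⟨⟨hx.1, lt_of_le_of_ne hx.2 hxq⟩, hxC⟩).2

/-- The bilinear form `∫ ⟪V', U'⟫ + ⟪S V, U⟫` over the interval `[p, q]`. -/
noncomputable def energyForm (S : ℝ → E →L[ℝ] E) (p q : ℝ) (V U : ℝ → E) : ℝ :=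
  ∫ t in p..q, ((inner ℝ (deriv V t) (deriv U t) : ℝ) + (inner ℝ (S t (V t)) (U t) : ℝ))

variable {S : ℝ → E →L[ℝ] E} {V V' U U' : ℝ → E}

theorem energyForm_congr (hpq : p ≤ q) (hV : EqOn V V' (Icc p q)) (hU : EqOn U U' (Icc p q)) :
    energyForm S p q V U = energyForm S p q V' U' := by
  refine intervalIntegral.integral_congr_uIoo fun x hx => ?_
  rw [uIoo_of_le hpq] at hx
  have hn := Icc_mem_nhds hx.1 hx.2
  simp only [(hV.eventuallyEq_of_mem hn).deriv_eq, (hU.eventuallyEq_of_mem hn).deriv_eq,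
    hV (Ioo_subset_Icc_self hx), hU (Ioo_subset_Icc_self hx)]

theorem energyForm_symm (hSsa : ∀ t x y, (inner ℝ (S t x) y : ℝ) = inner ℝ x (S t y)) :
    energyForm S p q V U = energyForm S p q U V := by
  unfold energyForm
  congr 1
  ext x
  rw [real_inner_comm, hSsa, real_inner_comm (S x (U x))]

theorem energyForm_smul_left (hV : PiecewiseC1On p q V) (k : ℝ) :
    energyForm S p q (k • V) U = k * energyForm S p q V U := by
  unfold energyForm
  rw [← intervalIntegral.integral_const_mul]
  refine intervalIntegral.integral_congr_ae ?_
  filter_upwards [hV.ae_differentiableAt] with x hx hxI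
  rw [deriv_const_smul _ (hx hxI)]
  simp only [Pi.smul_apply, map_smul, real_inner_smul_left]
  ring

variable [CompleteSpace E]

theorem intervalIntegrable_energy (hS : Continuous S) (hV : PiecewiseC1On p q V)
    (hU : PiecewiseC1On p q U) :
    IntervalIntegrable (fun t => (inner ℝ (deriv V t) (deriv U t) : ℝ) +
      (inner ℝ (S t (V t)) (U t) : ℝ)) volume p q :=
  (intervalIntegrable_inner_of_bounded hV.le hV.bounded_deriv_Ioc hU.bounded_deriv_Ioc).add
    (intervalIntegrable_inner_of_bounded hV.le (hS.continuousOn.clm_apply hV.1).bounded_Ioc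
      hU.1.bounded_Ioc)

theorem energyForm_add_adjacent (hS : Continuous S) (hV : PiecewiseC1On p r V)
    (hU : PiecewiseC1On p r U) (hpq : p ≤ q) (hqr : q ≤ r) :
    energyForm S p q V U + energyForm S q r V U = energyForm S p r V U :=
  intervalIntegral.integral_add_adjacent_intervals
    (intervalIntegrable_energy hS (hV.mono le_rfl hpq hqr) (hU.mono le_rfl hpq hqr))
    (intervalIntegrable_energy hS (hV.mono hpq hqr le_rfl) (hU.mono hpq hqr le_rfl))

theorem energyForm_add_left (hS : Continuous S) (hV : PiecewiseC1On p q V)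
    (hV' : PiecewiseC1On p q V') (hU : PiecewiseC1On p q U) :
    energyForm S p q (V + V') U = energyForm S p q V U + energyForm S p q V' U := by
  unfold energyForm
  rw [← intervalIntegral.integral_add (intervalIntegrable_energy hS hV hU)
    (intervalIntegrable_energy hS hV' hU)]
  refine intervalIntegral.integral_congr_ae ?_
  filter_upwards [hV.ae_differentiableAt, hV'.ae_differentiableAt] with x hx hx' hxI
  rw [deriv_add (hx hxI) (hx' hxI)]
  simp only [Pi.add_apply, map_add, inner_add_left]
  ring

/-- Integration by parts against a solution of the Jacobi equation. -/
theorem energyForm_eq_of_hasDerivAt (hS : Continuous S) {J J' : ℝ → E}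
    (hJ : ∀ t, HasDerivAt J (J' t) t) (hJ' : ∀ t, HasDerivAt J' (S t (J t)) t)
    (hU : PiecewiseC1On p q U) :
    energyForm S p q J U = (inner ℝ (J' q) (U q) : ℝ) - inner ℝ (J' p) (U p) := by
  obtain ⟨C, B, hC, hd⟩ := hU.exists_deriv_bound
  have hJc : Continuous J := continuous_iff_continuousAt.2 fun t => (hJ t).continuousAt
  have hJ'c : Continuous J' := continuous_iff_continuousAt.2 fun t => (hJ' t).continuousAt
  have hderiv : deriv J = J' := funext fun t => (hJ t).deriv
  unfold energyForm
  rw [hderiv]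
  refine integral_eq_of_hasDerivAt_off_countable_of_le (fun t => (inner ℝ (J' t) (U t) : ℝ)) _
    hU.le hC (hJ'c.continuousOn.inner hU.1)
    (fun x hx => (hJ' x).inner ℝ (hd x hx).1.hasDerivAt) ?_
  exact (intervalIntegrable_inner_of_bounded hU.le hJ'c.continuousOn.bounded_Ioc
    hU.bounded_deriv_Ioc).add (intervalIntegrable_inner_of_bounded hU.le
      (hS.clm_apply hJc).continuousOn.bounded_Ioc hU.1.bounded_Ioc)

/-- A Poincaré type inequality: on short intervals the energy form controls the `L²` norm of the
maps vanishing at the end points. -/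
theorem integral_norm_sq_le_energyForm (hS : Continuous S) {M : ℝ} (hM0 : 0 ≤ M)
    (hM : ∀ x ∈ Icc p q, ‖S x‖ ≤ M) (hpq : 4 * (M + 1) * (q - p) ^ 2 ≤ 1)
    (hV : PiecewiseC1On p q V) (hVp : V p = 0) (hVq : V q = 0) :
    ∫ x in p..q, ‖V x‖ ^ 2 ≤ energyForm S p q V V := by
  obtain ⟨C, B, hC, hd⟩ := hV.exists_deriv_bound
  let g : ℝ → ℝ := fun x => -(2 * (M + 1)) * (x - p) * ‖V x‖ ^ 2
  let g' : ℝ → ℝ := fun x =>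
    -(2 * (M + 1)) * ‖V x‖ ^ 2 + inner ℝ ((-(4 * (M + 1)) * (x - p)) • V x) (deriv V x)
  have hsq : IntervalIntegrable (fun x => ‖V x‖ ^ 2) volume p q := by
    simpa using intervalIntegrable_inner_of_bounded hV.le hV.1.bounded_Ioc hV.1.bounded_Ioc
  have hg'i : IntervalIntegrable g' volume p q := by
    refine (hsq.const_mul _).add (intervalIntegrable_inner_of_bounded hV.le
      (ContinuousOn.bounded_Ioc ?_) hV.bounded_deriv_Ioc)
    exact ContinuousOn.smul (by fun_prop) hV.1
  have hg : ∫ x in p..q, g' x = 0 := by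
    rw [integral_eq_of_hasDerivAt_off_countable_of_le g g' hV.le hC]
    · simp [g, hVp, hVq]
    · exact ContinuousOn.mul (by fun_prop) (hV.1.norm.pow 2)
    · intro x hx
      have h1 := (hd x hx).1.hasDerivAt.norm_sq
      have h2 : HasDerivAt (fun x => -(2 * (M + 1)) * (x - p)) (-(2 * (M + 1)) * 1) x :=
        ((hasDerivAt_id x).sub_const p).const_mul _
      refine (h2.mul h1).congr_deriv ?_
      simp only [g', real_inner_smul_left]
      ring
    · exact hg'i
  have hle : ∫ x in p..q, (‖V x‖ ^ 2 + g' x) ≤ energyForm S p q V V := by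
    refine intervalIntegral.integral_mono_on_of_le_Ioo hV.le (hsq.add hg'i)
      (intervalIntegrable_energy hS hV hV) fun x hx => ?_
    have h1 : 0 ≤ ‖deriv V x + (2 * (M + 1) * (x - p)) • V x‖ ^ 2 := by positivity
    rw [norm_add_sq_real, norm_smul, mul_pow, Real.norm_eq_abs, sq_abs, real_inner_smul_right] at h1
    have h2 : -(M * ‖V x‖ ^ 2) ≤ inner ℝ (S x (V x)) (V x) := by
      refine neg_le_of_abs_le ((abs_real_inner_le_norm _ _).trans ?_)
      rw [pow_two, ← mul_assoc]
      gcongr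
      exact (S x).le_of_opNorm_le (hM x (Ioo_subset_Icc_self hx)) _
    have h3 : (2 * (M + 1) * (x - p)) ^ 2 * ‖V x‖ ^ 2 ≤ (M + 1) * ‖V x‖ ^ 2 := by
      gcongr
      have : (x - p) ^ 2 ≤ (q - p) ^ 2 := by
        have h := hx.1.le
        have h' := hx.2.le
        exact pow_le_pow_left₀ (by linarith) (by linarith) 2
      calc (2 * (M + 1) * (x - p)) ^ 2 = (M + 1) * (4 * (M + 1) * (x - p) ^ 2) := by ring
        _ ≤ (M + 1) * (4 * (M + 1) * (q - p) ^ 2) := by gcongr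
        _ ≤ M + 1 := mul_le_of_le_one_right (by linarith) hpq
    simp only [g', real_inner_smul_left, real_inner_self_eq_norm_sq,
      real_inner_comm (deriv V x) (V x)]
    linarith
  rwa [intervalIntegral.integral_add hsq hg'i, hg, add_zero] at hle

theorem energyForm_nonneg (hS : Continuous S) {M : ℝ} (hM0 : 0 ≤ M)
    (hM : ∀ x ∈ Icc p q, ‖S x‖ ≤ M) (hpq : 4 * (M + 1) * (q - p) ^ 2 ≤ 1)
    (hV : PiecewiseC1On p q V) (hVp : V p = 0) (hVq : V q = 0) : 0 ≤ energyForm S p q V V :=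
  (intervalIntegral.integral_nonneg hV.le fun _ _ => by positivity).trans
    (integral_norm_sq_le_energyForm hS hM0 hM hpq hV hVp hVq)

theorem eq_zero_of_energyForm_nonpos (hS : Continuous S) {M : ℝ} (hM0 : 0 ≤ M)
    (hM : ∀ x ∈ Icc p q, ‖S x‖ ≤ M) (hpq : 4 * (M + 1) * (q - p) ^ 2 ≤ 1)
    (hV : PiecewiseC1On p q V) (hVp : V p = 0) (hVq : V q = 0)
    (h : energyForm S p q V V ≤ 0) : ∀ x ∈ Icc p q, V x = 0 := by
  by_contra! hne
  obtain ⟨x, hx, hVx⟩ := hne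
  have hlt : p < q := by
    refine lt_of_le_of_ne hV.le fun he => hVx ?_
    rw [le_antisymm (hx.2.trans_eq he.symm) hx.1, hVp]
  refine (intervalIntegral.integral_pos hlt (hV.1.norm.pow 2)
    (fun y _ => sq_nonneg ‖V y‖) ⟨x, hx, pow_pos (norm_pos_iff.2 hVx) 2⟩).not_ge
    ((integral_norm_sq_le_energyForm hS hM0 hM hpq hV hVp hVq).trans h)

end EnergyForm

theorem forall_of_forall_short_step {P : ℝ → Prop} {x₀ T η : ℝ} (hη : 0 < η) (hT : x₀ ≤ T)
    (h₀ : P x₀) (hstep : ∀ r r', x₀ ≤ r → r < r' → r' ≤ T → r' ≤ r + η → P r → P r') : P T := by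
  have key : ∀ k : ℕ, P (min (x₀ + k * η) T) := by
    intro k
    induction k with
    | zero => simpa [hT] using h₀
    | succ k ih =>
      have hk : x₀ + (k : ℝ) * η ≤ x₀ + ((k + 1 : ℕ) : ℝ) * η := by
        push_cast
        nlinarith
      rcases (min_le_min_right T hk).eq_or_lt with he | hlt
      · rwa [← he]
      · refine hstep _ _ (le_min ?_ hT) hlt (min_le_right _ _) ?_ ih
        · nlinarith [(Nat.cast_nonneg k : (0 : ℝ) ≤ k)]
        · rw [← min_add_add_right]
          refine min_le_min ?_ (by linarith)
          push_cast
          linarith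
  obtain ⟨k, hk⟩ := exists_nat_gt ((T - x₀) / η)
  rw [div_lt_iff₀ hη] at hk
  have := key k
  rwa [min_eq_right (by linarith)] at this

section BoundaryValueProblem

open Module

variable {n : ℕ} {S : ℝ → EuclideanSpace ℝ (Fin n) →L[ℝ] EuclideanSpace ℝ (Fin n)} {p q : ℝ}

/-- The energy form over `[p, q]` is positive definite on the maps vanishing at the end points. -/
def EnergyPosDefOn (S : ℝ → EuclideanSpace ℝ (Fin n) →L[ℝ] EuclideanSpace ℝ (Fin n))
    (p q : ℝ) : Prop :=
  ∀ V : ℝ → EuclideanSpace ℝ (Fin n), PiecewiseC1On p q V → V p = 0 → V q = 0 →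
    0 ≤ energyForm S p q V V ∧ (energyForm S p q V V ≤ 0 → ∀ x ∈ Icc p q, V x = 0)

theorem exists_energyPosDefOn (hS : Continuous S) (a T : ℝ) :
    ∃ δ > 0, ∀ p q, a ≤ p → p ≤ q → q ≤ T → q ≤ p + δ → EnergyPosDefOn S p q := by
  obtain ⟨M', hM'⟩ := (isCompact_Icc (a := a) (b := T)).exists_bound_of_continuousOn
    hS.continuousOn
  let M := max M' 0
  have hM0 : 0 ≤ M := le_max_right _ _
  have hδ : (0 : ℝ) < 4 * (M + 1) := by positivity
  refine ⟨1 / (4 * (M + 1)), by positivity, fun p q hp hpq hq hle V hV hVp hVq => ?_⟩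
  have hM : ∀ x ∈ Icc p q, ‖S x‖ ≤ M := fun x hx =>
    (hM' x ⟨hp.trans hx.1, hx.2.trans hq⟩).trans (le_max_left _ _)
  have hle' : q - p ≤ 1 / (4 * (M + 1)) := by linarith
  have hmul : 4 * (M + 1) * (q - p) ≤ 1 := by
    rwa [le_div_iff₀ hδ, mul_comm] at hle'
  have hshort : 4 * (M + 1) * (q - p) ^ 2 ≤ 1 := by
    have h1 : q - p ≤ 1 := hle'.trans (by rw [div_le_one hδ]; linarith)
    nlinarith
  exact ⟨energyForm_nonneg hS hM0 hM hshort hV hVp hVq,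
    eq_zero_of_energyForm_nonpos hS hM0 hM hshort hV hVp hVq⟩

theorem IsJacobiPair.contDiff {J J' : ℝ → EuclideanSpace ℝ (Fin n)} (h : IsJacobiPair S J J') :
    ContDiff ℝ 1 J := by
  rw [contDiff_one_iff_deriv]
  refine ⟨fun t => (h.1 t).differentiableAt, ?_⟩
  rw [show deriv J = J' from funext fun t => (h.1 t).deriv]
  exact continuous_iff_continuousAt.2 fun t => (h.2 t).continuousAt

/-- The boundary values at `p` and `q` of a Jacobi field. -/
def jacobiBoundary (S : ℝ → EuclideanSpace ℝ (Fin n) →L[ℝ] EuclideanSpace ℝ (Fin n)) (p q : ℝ) :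
    jacobiFields S →ₗ[ℝ] EuclideanSpace ℝ (Fin n) × EuclideanSpace ℝ (Fin n) where
  toFun J := (J.1.1 p, J.1.1 q)
  map_add' _ _ := rfl
  map_smul' _ _ := rfl

theorem EnergyPosDefOn.bijective_jacobiBoundary (hS : Continuous S) (h : EnergyPosDefOn S p q)
    (hpq : p < q) : Function.Bijective (jacobiBoundary S p q) := by
  have := finiteDimensional_jacobiFields hS
  have hinj : Function.Injective (jacobiBoundary S p q) := by
    rw [injective_iff_map_eq_zero]
    intro J hJ
    have hp : J.1.1 p = 0 := congrArg Prod.fst hJ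
    have hq : J.1.1 q = 0 := congrArg Prod.snd hJ
    have hpc := PiecewiseC1On.of_contDiff hpq.le J.2.contDiff
    refine jacobiFields_eq_of_eqOn hS hpq fun x hx => (h _ hpc hp hq).2 ?_ x hx
    rw [energyForm_eq_of_hasDerivAt hS J.2.1 J.2.2 hpc]
    simp [hp, hq]
  exact ⟨hinj, (LinearMap.injective_iff_surjective_of_finrank_eq_finrank
    (finrank_jacobiFields hS)).1 hinj⟩

open Classical in
/-- The Jacobi field with prescribed values at `p` and `q`, when the boundary value problem is
uniquely solvable (and `0` otherwise). -/
noncomputable def jacobiSolve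
    (S : ℝ → EuclideanSpace ℝ (Fin n) →L[ℝ] EuclideanSpace ℝ (Fin n)) (p q : ℝ) :
    EuclideanSpace ℝ (Fin n) × EuclideanSpace ℝ (Fin n) →ₗ[ℝ] jacobiFields S :=
  if h : Function.Bijective (jacobiBoundary S p q) then
    (LinearEquiv.ofBijective (jacobiBoundary S p q) h).symm.toLinearMap
  else 0

theorem jacobiBoundary_jacobiSolve (h : Function.Bijective (jacobiBoundary S p q))
    (v : EuclideanSpace ℝ (Fin n) × EuclideanSpace ℝ (Fin n)) :
    jacobiBoundary S p q (jacobiSolve S p q v) = v := by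
  rw [jacobiSolve, dif_pos h]
  exact (LinearEquiv.ofBijective (jacobiBoundary S p q) h).apply_symm_apply v

/-- The restriction to `(p, q]`, extended by zero, of the Jacobi field with prescribed values at
`p` and `q`. -/
noncomputable def jacobiPiece
    (S : ℝ → EuclideanSpace ℝ (Fin n) →L[ℝ] EuclideanSpace ℝ (Fin n)) (p q : ℝ) :
    EuclideanSpace ℝ (Fin n) × EuclideanSpace ℝ (Fin n) →ₗ[ℝ] ℝ → EuclideanSpace ℝ (Fin n) where
  toFun v := (Ioc p q).indicator (jacobiSolve S p q v).1.1
  map_add' v w := by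
    rw [map_add, ← indicator_add']
    rfl
  map_smul' k v := by
    rw [map_smul]
    exact indicator_const_smul _ k _

variable {a c s : ℝ} {X : ℝ → EuclideanSpace ℝ (Fin n)}

theorem add_jacobiPiece_eqOn_left (w : EuclideanSpace ℝ (Fin n)) :
    EqOn (X + jacobiPiece S c s (X c, w)) X (Icc a c) := by
  intro x hx
  have : x ∉ Ioc c s := fun h => h.1.not_ge hx.2
  simp [jacobiPiece, this]

theorem add_jacobiPiece_eqOn_right (h : Function.Bijective (jacobiBoundary S c s))
    (hX : ∀ x ∉ Icc a c, X x = 0) (w : EuclideanSpace ℝ (Fin n)) :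
    EqOn (X + jacobiPiece S c s (X c, w)) (jacobiSolve S c s (X c, w)).1.1 (Icc c s) := by
  intro x hx
  rcases hx.1.eq_or_lt with rfl | hlt
  · have : (jacobiSolve S c s (X c, w)).1.1 c = X c :=
      congrArg Prod.fst (jacobiBoundary_jacobiSolve h (X c, w))
    simp [jacobiPiece, this]
  · have hx' : x ∈ Ioc c s := ⟨hlt, hx.2⟩
    simp [jacobiPiece, hx', hX x fun h => h.2.not_gt hlt]

theorem add_jacobiPiece_apply_right (h : Function.Bijective (jacobiBoundary S c s)) (hcs : c ≤ s)
    (hX : ∀ x ∉ Icc a c, X x = 0) (w : EuclideanSpace ℝ (Fin n)) :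
    (X + jacobiPiece S c s (X c, w)) s = w :=
  (add_jacobiPiece_eqOn_right h hX w ⟨hcs, le_rfl⟩).trans
    (congrArg Prod.snd (jacobiBoundary_jacobiSolve h (X c, w)))

theorem add_jacobiPiece_eq_zero (hac : a ≤ c) (hcs : c ≤ s) (hX : ∀ x ∉ Icc a c, X x = 0)
    (w : EuclideanSpace ℝ (Fin n)) : ∀ x ∉ Icc a s, (X + jacobiPiece S c s (X c, w)) x = 0 := by
  intro x hx
  have h1 : x ∉ Icc a c := fun h => hx ⟨h.1, h.2.trans hcs⟩
  have h2 : x ∉ Ioc c s := fun h => hx ⟨hac.trans h.1.le, h.2⟩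
  simp [jacobiPiece, h2, hX x h1]

theorem piecewiseC1On_add_jacobiPiece (h : Function.Bijective (jacobiBoundary S c s)) (hcs : c ≤ s)
    (hXc : PiecewiseC1On a c X) (hX : ∀ x ∉ Icc a c, X x = 0) (w : EuclideanSpace ℝ (Fin n)) :
    PiecewiseC1On a s (X + jacobiPiece S c s (X c, w)) :=
  (hXc.congr (add_jacobiPiece_eqOn_left w)).trans
    ((PiecewiseC1On.of_contDiff hcs (jacobiSolve S c s (X c, w)).2.contDiff).congr
      (add_jacobiPiece_eqOn_right h hX w))

theorem energyForm_add_jacobiPiece (hS : Continuous S)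
    (h : Function.Bijective (jacobiBoundary S c s)) (hcs : c ≤ s)
    (hXc : PiecewiseC1On a c X) (hX : ∀ x ∉ Icc a c, X x = 0) (w : EuclideanSpace ℝ (Fin n))
    {U : ℝ → EuclideanSpace ℝ (Fin n)} (hU : PiecewiseC1On a s U) :
    energyForm S a s (X + jacobiPiece S c s (X c, w)) U = energyForm S a c X U +
      ((inner ℝ ((jacobiSolve S c s (X c, w)).1.2 s) (U s) : ℝ) -
        inner ℝ ((jacobiSolve S c s (X c, w)).1.2 c) (U c)) := by
  let J := jacobiSolve S c s (X c, w)
  rw [← energyForm_add_adjacent hS (piecewiseC1On_add_jacobiPiece h hcs hXc hX w) hU hXc.le hcs,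
    energyForm_congr hXc.le (add_jacobiPiece_eqOn_left w) (eqOn_refl U _),
    energyForm_congr hcs (add_jacobiPiece_eqOn_right h hX w) (eqOn_refl U _),
    energyForm_eq_of_hasDerivAt hS J.2.1 J.2.2 (hU.mono hXc.le hcs le_rfl)]

/-- A finite rank operator replacing a map by a broken Jacobi field on `[a, c]` with the same
values at the break points. -/
structure IsBrokenJacobiInterpolation
    (S : ℝ → EuclideanSpace ℝ (Fin n) →L[ℝ] EuclideanSpace ℝ (Fin n)) (a c : ℝ)
    (P : (ℝ → EuclideanSpace ℝ (Fin n)) →ₗ[ℝ] ℝ → EuclideanSpace ℝ (Fin n)) : Prop where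
  finiteDimensional_range : FiniteDimensional ℝ (LinearMap.range P)
  piecewiseC1On : ∀ V, PiecewiseC1On a c (P V)
  apply_left : ∀ V, P V a = V a
  apply_right : ∀ V, P V c = V c
  eq_zero : ∀ V, ∀ x ∉ Icc a c, P V x = 0
  energyForm_eq_zero : ∀ V, PiecewiseC1On a c V → ∀ X, energyForm S a c (P X) (V - P V) = 0
  energyForm_nonneg : ∀ V, PiecewiseC1On a c V → 0 ≤ energyForm S a c (V - P V) (V - P V)

theorem exists_isBrokenJacobiInterpolation_self
    (S : ℝ → EuclideanSpace ℝ (Fin n) →L[ℝ] EuclideanSpace ℝ (Fin n)) (a : ℝ) :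
    ∃ P, IsBrokenJacobiInterpolation S a a P := by
  classical
  let L : EuclideanSpace ℝ (Fin n) →ₗ[ℝ] ℝ → EuclideanSpace ℝ (Fin n) :=
    LinearMap.single ℝ (fun _ : ℝ => EuclideanSpace ℝ (Fin n)) a
  refine ⟨L ∘ₗ LinearMap.proj a, ?_, fun V => ?_, fun V => ?_, fun V => ?_, fun V x hx => ?_,
    fun V _ X => ?_, fun V _ => ?_⟩
  · exact Submodule.finiteDimensional_of_le (LinearMap.range_comp_le_range _ L)
  · refine .of_finset le_rfl ?_ ∅ fun p q hp hpq hq => absurd (hp.trans_lt hpq) hq.not_gt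
    rw [Icc_self]
    exact continuousOn_singleton _ _
  · simp [L]
  · simp [L]
  · have hx' : x ≠ a := fun h => hx (by simp [h])
    simp [L, hx']
  · simp [energyForm]
  · simp [energyForm]

theorem IsBrokenJacobiInterpolation.exists_step (hS : Continuous S)
    (h : EnergyPosDefOn S c s) (hcs : c < s)
    {P : (ℝ → EuclideanSpace ℝ (Fin n)) →ₗ[ℝ] ℝ → EuclideanSpace ℝ (Fin n)}
    (hP : IsBrokenJacobiInterpolation S a c P) :
    ∃ P', IsBrokenJacobiInterpolation S a s P' ∧
      ∀ V, P' V = P V + jacobiPiece S c s (P V c, V s) := by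
  have hbij := h.bijective_jacobiBoundary hS hcs
  have hac : a ≤ c := (hP.piecewiseC1On 0).le
  let ev : (ℝ → EuclideanSpace ℝ (Fin n)) →ₗ[ℝ]
      EuclideanSpace ℝ (Fin n) × EuclideanSpace ℝ (Fin n) :=
    (LinearMap.proj c).prod (LinearMap.proj s)
  let P' := P + jacobiPiece S c s ∘ₗ ev
  have hP' : ∀ V, P' V = P V + jacobiPiece S c s (P V c, V s) := fun V => by
    rw [hP.apply_right]
    rfl
  have hleft : ∀ V, EqOn (P' V) (P V) (Icc a c) := fun V => by
    rw [hP']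
    exact add_jacobiPiece_eqOn_left _
  have hpc : ∀ V, PiecewiseC1On a s (P' V) := fun V => by
    rw [hP']
    exact piecewiseC1On_add_jacobiPiece hbij hcs.le (hP.piecewiseC1On V) (hP.eq_zero V) _
  have hc : ∀ V, P' V c = V c := fun V => by rw [hleft V ⟨hac, le_rfl⟩, hP.apply_right]
  have hs : ∀ V, P' V s = V s := fun V => by
    rw [hP', add_jacobiPiece_apply_right hbij hcs.le (hP.eq_zero V)]
  have hsub : ∀ V, EqOn (V - P' V) (V - P V) (Icc a c) := fun V x hx => by
    simp [hleft V hx]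
  refine ⟨P', ⟨?_, hpc, fun V => ?_, hs, fun V => ?_, fun V hV X => ?_, fun V hV => ?_⟩, hP'⟩
  · have h1 := hP.finiteDimensional_range
    have h2 := Submodule.finiteDimensional_of_le
      (LinearMap.range_comp_le_range ev (jacobiPiece S c s))
    exact Submodule.finiteDimensional_of_le (LinearMap.range_add_le _ _)
  · rw [hleft V ⟨le_rfl, hac⟩, hP.apply_left]
  · rw [hP']
    exact add_jacobiPiece_eq_zero hac hcs.le (hP.eq_zero V) _
  · rw [hP' X, energyForm_add_jacobiPiece hS hbij hcs.le (hP.piecewiseC1On X) (hP.eq_zero X) _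
      (hV.sub (hpc V)), energyForm_congr hac (eqOn_refl _ _) (hsub V),
      hP.energyForm_eq_zero V (hV.mono le_rfl hac hcs.le)]
    simp [hc, hs]
  · have hV' := hV.sub (hpc V)
    rw [← energyForm_add_adjacent hS hV' hV' hac hcs.le, energyForm_congr hac (hsub V) (hsub V)]
    refine add_nonneg (hP.energyForm_nonneg V (hV.mono le_rfl hac hcs.le))
      (h _ (hV'.mono hac hcs.le le_rfl) ?_ ?_).1
    · simp [hc]
    · simp [hs]

theorem exists_isBrokenJacobiInterpolation (hS : Continuous S) (hac : a ≤ c) :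
    ∃ P, IsBrokenJacobiInterpolation S a c P := by
  obtain ⟨δ, hδ, h⟩ := exists_energyPosDefOn hS a c
  refine forall_of_forall_short_step (P := fun r => ∃ P, IsBrokenJacobiInterpolation S a r P) hδ hac
    (exists_isBrokenJacobiInterpolation_self S a) ?_
  rintro r r' har hrr' hr'c hle ⟨P, hP⟩
  obtain ⟨P', hP', -⟩ := hP.exists_step hS (h r r' har hrr'.le hr'c hle) hrr'
  exact ⟨P', hP'⟩

end BoundaryValueProblem

section IndexForm

variable {n : ℕ} {S : ℝ → EuclideanSpace ℝ (Fin n) →L[ℝ] EuclideanSpace ℝ (Fin n)}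
  {σ : EuclideanSpace ℝ (Fin n) →ₗ[ℝ] EuclideanSpace ℝ (Fin n) →ₗ[ℝ] ℝ}
  {W : Submodule ℝ (EuclideanSpace ℝ (Fin n))} {a c s t : ℝ}
  {V V' U : ℝ → EuclideanSpace ℝ (Fin n)}

theorem indexForm_eq_energyForm_sub :
    indexForm S σ a t V U = energyForm S a t V U - σ (V a) (U a) :=
  rfl

theorem indexForm_symm (hSsa : ∀ t x y, (inner ℝ (S t x) y : ℝ) = inner ℝ x (S t y))
    (hσ : ∀ x y, σ x y = σ y x) : indexForm S σ a t V U = indexForm S σ a t U V := by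
  rw [indexForm_eq_energyForm_sub, indexForm_eq_energyForm_sub, energyForm_symm hSsa, hσ]

theorem energyForm_zero_right : energyForm S a t V 0 = 0 := by
  simp [energyForm]

theorem indexForm_zero_right : indexForm S σ a t V 0 = 0 := by
  simp [indexForm_eq_energyForm_sub, energyForm_zero_right]

/-- The index form pulled back by a linear map into the space of piecewise `C¹` maps. -/
noncomputable def indexFormPullback {M : Type*} [AddCommGroup M] [Module ℝ M] (hS : Continuous S)
    (hSsa : ∀ t x y, (inner ℝ (S t x) y : ℝ) = inner ℝ x (S t y))
    (σ : EuclideanSpace ℝ (Fin n) →ₗ[ℝ] EuclideanSpace ℝ (Fin n) →ₗ[ℝ] ℝ)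
    (T : M →ₗ[ℝ] ℝ → EuclideanSpace ℝ (Fin n)) (hT : ∀ m, PiecewiseC1On a t (T m)) :
    M →ₗ[ℝ] M →ₗ[ℝ] ℝ :=
  LinearMap.mk₂ ℝ (fun x y => indexForm S σ a t (T x) (T y))
    (fun x x' y => by
      simp only [indexForm_eq_energyForm_sub, map_add, Pi.add_apply, LinearMap.add_apply]
      rw [energyForm_add_left hS (hT x) (hT x') (hT y)]
      ring)
    (fun k x y => by
      simp only [indexForm_eq_energyForm_sub, map_smul, Pi.smul_apply, LinearMap.smul_apply,
        smul_eq_mul]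
      rw [energyForm_smul_left (hT x)]
      ring)
    (fun x y y' => by
      simp only [indexForm_eq_energyForm_sub, map_add, Pi.add_apply]
      rw [energyForm_symm hSsa, energyForm_add_left hS (hT y) (hT y') (hT x),
        energyForm_symm hSsa, energyForm_symm hSsa (V := T y')]
      ring)
    (fun k x y => by
      simp only [indexForm_eq_energyForm_sub, map_smul, Pi.smul_apply, smul_eq_mul]
      rw [energyForm_symm hSsa, energyForm_smul_left (hT y), energyForm_symm hSsa]
      ring)

/-- A map in the null space of the index form is a Jacobi field on every short interval. -/
theorem exists_jacobiField_eqOn_short (hS : Continuous S)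
    {X : ℝ → EuclideanSpace ℝ (Fin n)} (hX : PiecewiseC1On a t X)
    (hnull : ∀ U ∈ HPt W a t, indexForm S σ a t X U = 0) {p q : ℝ} (hap : a ≤ p) (hpq : p < q)
    (hqt : q ≤ t) (h : EnergyPosDefOn S p q) :
    ∃ J : jacobiFields S, ∀ x ∈ Icc p q, X x = J.1.1 x := by
  have hbij := h.bijective_jacobiBoundary hS hpq
  let J := jacobiSolve S p q (X p, X q)
  have hJp : J.1.1 p = X p := congrArg Prod.fst (jacobiBoundary_jacobiSolve hbij (X p, X q))
  have hJq : J.1.1 q = X q := congrArg Prod.snd (jacobiBoundary_jacobiSolve hbij (X p, X q))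
  let D := X - J.1.1
  have hDp : D p = 0 := by simp [D, hJp]
  have hDq : D q = 0 := by simp [D, hJq]
  have hJc := PiecewiseC1On.of_contDiff hpq.le J.2.contDiff
  have hXpq := hX.mono hap hpq.le hqt
  have hD : PiecewiseC1On p q D := hXpq.sub hJc
  let U := (Icc p q).indicator D
  have hzero : PiecewiseC1On a p U ∧ EqOn U 0 (Icc a p) := by
    have : EqOn U 0 (Icc a p) := fun x hx => by
      rcases hx.2.eq_or_lt with rfl | hlt
      · simp [U, hDp]
      · exact indicator_of_notMem (fun hx' => hx'.1.not_gt hlt) _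
    exact ⟨(PiecewiseC1On.of_contDiff hap contDiff_const).congr this, this⟩
  have hzero' : PiecewiseC1On q t U ∧ EqOn U 0 (Icc q t) := by
    have : EqOn U 0 (Icc q t) := fun x hx => by
      rcases hx.1.eq_or_lt with rfl | hlt
      · simp [U, hDq]
      · exact indicator_of_notMem (fun hx' => hx'.2.not_gt hlt) _
    exact ⟨(PiecewiseC1On.of_contDiff hqt contDiff_const).congr this, this⟩
  have hUD : EqOn U D (Icc p q) := fun x hx => indicator_of_mem hx _
  have hU : PiecewiseC1On a t U := (hzero.1.trans (hD.congr hUD)).trans hzero'.1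
  have hUa : U a = 0 := hzero.2 ⟨le_rfl, hap⟩
  have hUt : U t = 0 := hzero'.2 ⟨hqt, le_rfl⟩
  have h0 := hnull U ⟨hU, by rw [hUa]; exact W.zero_mem, hUt⟩
  rw [indexForm_eq_energyForm_sub, hUa, map_zero, sub_zero,
    ← energyForm_add_adjacent hS hX hU (hap.trans hpq.le) hqt,
    ← energyForm_add_adjacent hS (hX.mono le_rfl (hap.trans hpq.le) hqt)
      (hU.mono le_rfl (hap.trans hpq.le) hqt) hap hpq.le,
    energyForm_congr hap (eqOn_refl X _) hzero.2, energyForm_congr hqt (eqOn_refl X _) hzero'.2,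
    energyForm_congr hpq.le (eqOn_refl X _) hUD, energyForm_zero_right, energyForm_zero_right,
    zero_add, add_zero] at h0
  have h1 : energyForm S p q J.1.1 D = 0 := by
    rw [energyForm_eq_of_hasDerivAt hS J.2.1 J.2.2 hD, hDp, hDq]
    simp
  have h2 : energyForm S p q X D = energyForm S p q J.1.1 D + energyForm S p q D D := by
    rw [← energyForm_add_left hS hJc hD hD]
    simp [D]
  refine ⟨J, fun x hx => sub_eq_zero.1 ((h D hD hDp hDq).2 (by linarith) x hx)⟩

/-- The maps in the null space of the index form on `H^P_t` are `P`-Jacobi fields. -/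
theorem exists_pJacobi_eqOn (hS : Continuous S) (hat : a < t)
    {X : ℝ → EuclideanSpace ℝ (Fin n)} (hX : X ∈ HPt W a t)
    (hnull : ∀ U ∈ HPt W a t, indexForm S σ a t X U = 0) :
    ∃ J ∈ pJacobiVanishingAt S σ W a t, ∀ x ∈ Icc a t, X x = J.1 x := by
  obtain ⟨hXc, hXa, hXt⟩ := hX
  obtain ⟨δ, hδ, hpos⟩ := exists_energyPosDefOn hS a t
  have hshort : ∀ p q, a ≤ p → p < q → q ≤ t → q ≤ p + δ →
      ∃ J : jacobiFields S, ∀ x ∈ Icc p q, X x = J.1.1 x := fun p q hp hpq hq hle =>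
    exists_jacobiField_eqOn_short hS hXc hnull hp hpq hq (hpos p q hp hpq.le hq hle)
  obtain ⟨J, hJ⟩ : ∃ J : jacobiFields S, ∀ x ∈ Icc a t, X x = J.1.1 x := by
    rcases le_or_gt t (a + δ) with hle | hgt
    · exact hshort a t le_rfl hat le_rfl hle
    · refine forall_of_forall_short_step (P := fun r => ∃ J : jacobiFields S, ∀ x ∈ Icc a r,
        X x = J.1.1 x) (half_pos hδ) hgt.le
        (hshort a (a + δ) le_rfl (by linarith) hgt.le le_rfl) ?_
      rintro r r' har hrr' hr't hle ⟨J, hJ⟩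
      obtain ⟨K, hK⟩ := hshort (r - δ / 2) r' (by linarith) (by linarith) hr't (by linarith)
      have hJK : J = K := jacobiFields_eq_of_eqOn hS (show r - δ / 2 < r by linarith)
        fun x hx => (hJ x ⟨by linarith [hx.1], hx.2⟩).symm.trans (hK x ⟨hx.1, hx.2.trans hrr'.le⟩)
      refine ⟨J, fun x hx => ?_⟩
      rcases le_or_gt x r with hxr | hxr
      · exact hJ x ⟨hx.1, hxr⟩
      · rw [hJK]
        exact hK x ⟨by linarith, hx.2⟩
  have hJa := hJ a ⟨le_rfl, hat.le⟩
  have hJt := hJ t ⟨hat.le, le_rfl⟩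
  refine ⟨J.1, ⟨⟨J.2, hJa ▸ hXa, fun w hw => ?_⟩, hJt ▸ hXt⟩, hJ⟩
  let U : ℝ → EuclideanSpace ℝ (Fin n) := fun x => ((t - x) / (t - a)) • w
  have hU : PiecewiseC1On a t U := .of_contDiff hat.le (by fun_prop)
  have hUa : U a = w := by simp [U, div_self (sub_pos.2 hat).ne']
  have hUt : U t = 0 := by simp [U]
  have h0 := hnull U ⟨hU, by rwa [hUa], hUt⟩
  rw [indexForm_eq_energyForm_sub, energyForm_congr hat.le hJ (eqOn_refl U _),
    energyForm_eq_of_hasDerivAt hS J.2.1 J.2.2 hU, hUa, hUt, hJa, inner_zero_right] at h0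
  linarith

theorem IsBrokenJacobiInterpolation.energyForm_le (hS : Continuous S)
    (hSsa : ∀ t x y, (inner ℝ (S t x) y : ℝ) = inner ℝ x (S t y))
    {P : (ℝ → EuclideanSpace ℝ (Fin n)) →ₗ[ℝ] ℝ → EuclideanSpace ℝ (Fin n)}
    (hP : IsBrokenJacobiInterpolation S a c P) (hV : PiecewiseC1On a c V) :
    energyForm S a c (P V) (P V) ≤ energyForm S a c V V := by
  have hPV := hP.piecewiseC1On V
  have hD := hV.sub hPV
  have h1 : energyForm S a c V V =
      energyForm S a c (P V) V + energyForm S a c (V - P V) V := by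
    rw [← energyForm_add_left hS hPV hD hV, add_sub_cancel]
  have h2 : energyForm S a c V (P V) =
      energyForm S a c (P V) (P V) + energyForm S a c (V - P V) (P V) := by
    rw [← energyForm_add_left hS hPV hD hPV, add_sub_cancel]
  have h3 : energyForm S a c V (V - P V) =
      energyForm S a c (P V) (V - P V) + energyForm S a c (V - P V) (V - P V) := by
    rw [← energyForm_add_left hS hPV hD hD, add_sub_cancel]
  have h4 := hP.energyForm_eq_zero V hV V
  have h5 := hP.energyForm_nonneg V hV
  rw [energyForm_symm hSsa] at h2 h3 h4
  rw [energyForm_symm hSsa (V := P V) (U := V - P V)] at h3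
  linarith

end IndexForm

section Reduction

open Filter Topology Module

variable {n : ℕ} {S : ℝ → EuclideanSpace ℝ (Fin n) →L[ℝ] EuclideanSpace ℝ (Fin n)}
  {σ : EuclideanSpace ℝ (Fin n) →ₗ[ℝ] EuclideanSpace ℝ (Fin n) →ₗ[ℝ] ℝ}
  {W : Submodule ℝ (EuclideanSpace ℝ (Fin n))} {a c s t : ℝ}
  {P : (ℝ → EuclideanSpace ℝ (Fin n)) →ₗ[ℝ] ℝ → EuclideanSpace ℝ (Fin n)}

/-- The solution of a boundary value problem depends continuously on the right end point. -/
theorem tendsto_jacobiSolve_snd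
    (hbij : ∀ᶠ s in 𝓝 t, Function.Bijective (jacobiBoundary S c s))
    (v : EuclideanSpace ℝ (Fin n) × EuclideanSpace ℝ (Fin n)) (x : ℝ) :
    Tendsto (fun s => (jacobiSolve S c s v).1.2 x) (𝓝 t) (𝓝 ((jacobiSolve S c t v).1.2 x)) := by
  let g : ℝ → (EuclideanSpace ℝ (Fin n) × EuclideanSpace ℝ (Fin n)) →L[ℝ]
      (EuclideanSpace ℝ (Fin n) × EuclideanSpace ℝ (Fin n)) := fun s =>
    (jacobiBoundary S c s ∘ₗ jacobiSolve S c t).toContinuousLinearMap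
  have hg : Continuous g := continuous_clm_apply.2 fun w =>
    continuous_const.prodMk (jacobiSolve S c t w).2.contDiff.continuous
  have hgt : g t = 1 := ContinuousLinearMap.ext fun w =>
    jacobiBoundary_jacobiSolve hbij.self_of_nhds w
  let L : (EuclideanSpace ℝ (Fin n) × EuclideanSpace ℝ (Fin n)) →ₗ[ℝ] EuclideanSpace ℝ (Fin n) :=
    LinearMap.snd ℝ _ _ ∘ₗ jacobiCauchy S x ∘ₗ jacobiSolve S c t
  have hinv : Tendsto (fun s => Ring.inverse (g s)) (𝓝 t) (𝓝 1) := by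
    have h1 := NormedRing.inverse_continuousAt
      (1 : ((EuclideanSpace ℝ (Fin n) × EuclideanSpace ℝ (Fin n)) →L[ℝ]
        (EuclideanSpace ℝ (Fin n) × EuclideanSpace ℝ (Fin n)))ˣ)
    have h2 : Tendsto g (𝓝 t) (𝓝 1) := hgt ▸ hg.continuousAt
    simpa [Function.comp_def] using h1.tendsto.comp h2
  have hunit : ∀ᶠ s in 𝓝 t, IsUnit (g s) :=
    hg.continuousAt.eventually (Units.isOpen.mem_nhds (hgt ▸ isUnit_one))
  have hlim : Tendsto (fun s => L (Ring.inverse (g s) v)) (𝓝 t) (𝓝 (L v)) :=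
    (L.continuous_of_finiteDimensional.tendsto _).comp
      (((ContinuousLinearMap.apply ℝ _ v).continuous.tendsto _).comp hinv)
  refine hlim.congr' ?_
  filter_upwards [hbij, hunit] with s hs hu
  have : jacobiSolve S c t (Ring.inverse (g s) v) = jacobiSolve S c s v := by
    refine hs.1 ?_
    rw [jacobiBoundary_jacobiSolve hs]
    exact congrArg (fun A : (EuclideanSpace ℝ (Fin n) × EuclideanSpace ℝ (Fin n)) →L[ℝ]
      (EuclideanSpace ℝ (Fin n) × EuclideanSpace ℝ (Fin n)) => A v) (Ring.mul_inverse_cancel _ hu)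
  exact congrArg (fun J : jacobiFields S => J.1.2 x) this

/-- The space of broken Jacobi fields on `[a, c]` with initial value in `W`. -/
def brokenJacobiSpace (W : Submodule ℝ (EuclideanSpace ℝ (Fin n))) (a : ℝ)
    (P : (ℝ → EuclideanSpace ℝ (Fin n)) →ₗ[ℝ] ℝ → EuclideanSpace ℝ (Fin n)) :
    Submodule ℝ (ℝ → EuclideanSpace ℝ (Fin n)) :=
  LinearMap.range P ⊓ W.comap (LinearMap.proj a)

namespace IsBrokenJacobiInterpolation

theorem piecewiseC1On_of_mem (hP : IsBrokenJacobiInterpolation S a c P)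
    (X : brokenJacobiSpace W a P) : PiecewiseC1On a c X.1 := by
  obtain ⟨V, hV⟩ := X.2.1
  rw [← hV]
  exact hP.piecewiseC1On V

theorem eq_zero_of_mem (hP : IsBrokenJacobiInterpolation S a c P)
    (X : brokenJacobiSpace W a P) : ∀ x ∉ Icc a c, X.1 x = 0 := by
  obtain ⟨V, hV⟩ := X.2.1
  rw [← hV]
  exact hP.eq_zero V

theorem apply_mem (hP : IsBrokenJacobiInterpolation S a c P)
    {V : ℝ → EuclideanSpace ℝ (Fin n)} (hV : V a ∈ W) : P V ∈ brokenJacobiSpace W a P :=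
  ⟨⟨V, rfl⟩, by simpa [hP.apply_left] using hV⟩

/-- The index form of `[a, s]` on broken Jacobi fields on `[a, c]`, extended to `[c, s]` by a
Jacobi field vanishing at `s`. -/
noncomputable def reducedForm (hP : IsBrokenJacobiInterpolation S a c P) (hS : Continuous S)
    (hSsa : ∀ t x y, (inner ℝ (S t x) y : ℝ) = inner ℝ x (S t y))
    (σ : EuclideanSpace ℝ (Fin n) →ₗ[ℝ] EuclideanSpace ℝ (Fin n) →ₗ[ℝ] ℝ)
    (W : Submodule ℝ (EuclideanSpace ℝ (Fin n))) (s : ℝ) :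
    brokenJacobiSpace W a P →ₗ[ℝ] brokenJacobiSpace W a P →ₗ[ℝ] ℝ :=
  indexFormPullback hS hSsa σ (brokenJacobiSpace W a P).subtype hP.piecewiseC1On_of_mem -
    (innerₗ (EuclideanSpace ℝ (Fin n))).compl₁₂
      (LinearMap.snd ℝ _ _ ∘ₗ jacobiCauchy S c ∘ₗ jacobiSolve S c s ∘ₗ LinearMap.inl ℝ _ _ ∘ₗ
        LinearMap.proj c ∘ₗ (brokenJacobiSpace W a P).subtype)
      (LinearMap.proj c ∘ₗ (brokenJacobiSpace W a P).subtype)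

theorem reducedForm_apply (hP : IsBrokenJacobiInterpolation S a c P) (hS : Continuous S)
    (hSsa : ∀ t x y, (inner ℝ (S t x) y : ℝ) = inner ℝ x (S t y)) (s : ℝ)
    (X Y : brokenJacobiSpace W a P) :
    hP.reducedForm hS hSsa σ W s X Y = indexForm S σ a c X.1 Y.1 -
      inner ℝ ((jacobiSolve S c s (X.1 c, 0)).1.2 c) (Y.1 c) :=
  rfl

theorem tendsto_reducedForm (hP : IsBrokenJacobiInterpolation S a c P) (hS : Continuous S)
    (hSsa : ∀ t x y, (inner ℝ (S t x) y : ℝ) = inner ℝ x (S t y))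
    (hbij : ∀ᶠ s in 𝓝 t, Function.Bijective (jacobiBoundary S c s))
    (X Y : brokenJacobiSpace W a P) :
    Tendsto (fun s => hP.reducedForm hS hSsa σ W s X Y) (𝓝 t)
      (𝓝 (hP.reducedForm hS hSsa σ W t X Y)) := by
  simp only [reducedForm_apply]
  exact ((tendsto_jacobiSolve_snd hbij _ c).inner tendsto_const_nhds).const_sub _

/-- Extension of broken Jacobi fields on `[a, c]` by a Jacobi field vanishing at `s`. -/
noncomputable def extendTo (S : ℝ → EuclideanSpace ℝ (Fin n) →L[ℝ] EuclideanSpace ℝ (Fin n))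
    (c s : ℝ) : (ℝ → EuclideanSpace ℝ (Fin n)) →ₗ[ℝ] ℝ → EuclideanSpace ℝ (Fin n) :=
  LinearMap.id + jacobiPiece S c s ∘ₗ LinearMap.inl ℝ _ _ ∘ₗ LinearMap.proj c

theorem extendTo_apply (X : ℝ → EuclideanSpace ℝ (Fin n)) :
    extendTo S c s X = X + jacobiPiece S c s (X c, 0) :=
  rfl

theorem extendTo_mem (hP : IsBrokenJacobiInterpolation S a c P)
    (hbij : Function.Bijective (jacobiBoundary S c s)) (hcs : c ≤ s)
    (X : brokenJacobiSpace W a P) : extendTo S c s X.1 ∈ HPt W a s := by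
  have hX := hP.piecewiseC1On_of_mem X
  have hX0 := hP.eq_zero_of_mem X
  refine ⟨piecewiseC1On_add_jacobiPiece hbij hcs hX hX0 0, ?_,
    add_jacobiPiece_apply_right hbij hcs hX0 0⟩
  rw [extendTo_apply, add_jacobiPiece_eqOn_left 0 (left_mem_Icc.2 hX.le)]
  exact X.2.2

theorem indexForm_extendTo (hP : IsBrokenJacobiInterpolation S a c P) (hS : Continuous S)
    (hbij : Function.Bijective (jacobiBoundary S c s)) (hcs : c ≤ s)
    (X : brokenJacobiSpace W a P) {U : ℝ → EuclideanSpace ℝ (Fin n)} (hU : U ∈ HPt W a s) :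
    indexForm S σ a s (extendTo S c s X.1) U = indexForm S σ a c X.1 U -
      inner ℝ ((jacobiSolve S c s (X.1 c, 0)).1.2 c) (U c) := by
  obtain ⟨hUc, -, hUs⟩ := hU
  have hX := hP.piecewiseC1On_of_mem X
  rw [indexForm_eq_energyForm_sub, indexForm_eq_energyForm_sub, extendTo_apply,
    energyForm_add_jacobiPiece hS hbij hcs hX (hP.eq_zero_of_mem X) 0 hUc, hUs,
    add_jacobiPiece_eqOn_left 0 (left_mem_Icc.2 hX.le), inner_zero_right]
  ring

theorem indexForm_extendTo_extendTo (hP : IsBrokenJacobiInterpolation S a c P) (hS : Continuous S)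
    (hSsa : ∀ t x y, (inner ℝ (S t x) y : ℝ) = inner ℝ x (S t y))
    (hbij : Function.Bijective (jacobiBoundary S c s)) (hcs : c ≤ s)
    (X Y : brokenJacobiSpace W a P) :
    indexForm S σ a s (extendTo S c s X.1) (extendTo S c s Y.1) =
      hP.reducedForm hS hSsa σ W s X Y := by
  have hac := (hP.piecewiseC1On_of_mem X).le
  have hY : EqOn (extendTo S c s Y.1) Y.1 (Icc a c) := add_jacobiPiece_eqOn_left 0
  rw [hP.indexForm_extendTo hS hbij hcs X (hP.extendTo_mem hbij hcs Y), reducedForm_apply,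
    indexForm_eq_energyForm_sub, indexForm_eq_energyForm_sub,
    energyForm_congr hac (eqOn_refl _ _) hY, hY (left_mem_Icc.2 hac), hY (right_mem_Icc.2 hac)]

theorem indexForm_extendTo_eq_reducedForm (hP : IsBrokenJacobiInterpolation S a c P)
    (hS : Continuous S) (hSsa : ∀ t x y, (inner ℝ (S t x) y : ℝ) = inner ℝ x (S t y))
    (hbij : Function.Bijective (jacobiBoundary S c s)) (hcs : c ≤ s)
    (X : brokenJacobiSpace W a P) {U : ℝ → EuclideanSpace ℝ (Fin n)} (hU : U ∈ HPt W a s) :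
    indexForm S σ a s (extendTo S c s X.1) U =
      hP.reducedForm hS hSsa σ W s X ⟨P U, hP.apply_mem hU.2.1⟩ := by
  have hX := hP.piecewiseC1On_of_mem X
  have hPU := hP.piecewiseC1On U
  have hUc := hU.1.mono le_rfl hX.le hcs
  have horth : energyForm S a c X.1 U = energyForm S a c X.1 (P U) := by
    obtain ⟨V, hV⟩ := X.2.1
    have h0 := hP.energyForm_eq_zero U hUc V
    rw [hV, energyForm_symm hSsa] at h0
    have h1 := energyForm_add_left hS (hUc.sub hPU) hPU hX
    rwa [h0, zero_add, sub_add_cancel, energyForm_symm hSsa, energyForm_symm hSsa (V := P U)] at h1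
  rw [hP.indexForm_extendTo hS hbij hcs X hU, reducedForm_apply, indexForm_eq_energyForm_sub,
    indexForm_eq_energyForm_sub, horth]
  simp only [hP.apply_left, hP.apply_right]

theorem reducedForm_le_indexForm (hP : IsBrokenJacobiInterpolation S a c P)
    (hS : Continuous S) (hSsa : ∀ t x y, (inner ℝ (S t x) y : ℝ) = inner ℝ x (S t y))
    (hpos : EnergyPosDefOn S c s) (hcs : c < s)
    {V : ℝ → EuclideanSpace ℝ (Fin n)} (hV : V ∈ HPt W a s) :
    hP.reducedForm hS hSsa σ W s ⟨P V, hP.apply_mem hV.2.1⟩ ⟨P V, hP.apply_mem hV.2.1⟩ ≤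
      indexForm S σ a s V V := by
  obtain ⟨P', hP', hP'V⟩ := hP.exists_step hS hpos hcs
  have hle := hP'.energyForm_le hS hSsa hV.1
  have hext : P' V = extendTo S c s (P V) := by rw [hP'V, hV.2.2]; rfl
  rw [← hP.indexForm_extendTo_extendTo hS hSsa (hpos.bijective_jacobiBoundary hS hcs) hcs.le,
    ← hext, indexForm_eq_energyForm_sub, indexForm_eq_energyForm_sub, hP'.apply_left]
  linarith

/-- The Morse index is the index of the reduced form. -/
theorem morseIndexFun_eq (hP : IsBrokenJacobiInterpolation S a c P)
    (hS : Continuous S) (hSsa : ∀ t x y, (inner ℝ (S t x) y : ℝ) = inner ℝ x (S t y))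
    (hpos : EnergyPosDefOn S c s) (hcs : c < s) :
    morseIndexFun S σ W a s = indexOn (fun X Y => hP.reducedForm hS hSsa σ W s X Y) univ := by
  have hbij := hpos.bijective_jacobiBoundary hS hcs
  unfold morseIndexFun
  refine le_antisymm (iSup₂_le fun U hU => ?_) (iSup₂_le fun U hU => ?_)
  · obtain ⟨hUH, hfd, hneg⟩ := hU
    refine finrank_le_indexOn (by simp)
      ((P ∘ₗ U.subtype).codRestrict (brokenJacobiSpace W a P) fun u =>
        hP.apply_mem (hUH u.2).2.1) (fun _ => mem_univ _) fun u hu => ?_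
    exact (hP.reducedForm_le_indexForm hS hSsa hpos hcs (hUH u.2)).trans_lt
      (hneg u u.2 fun h => hu (Subtype.ext h))
  · obtain ⟨-, hfd, hneg⟩ := hU
    let T : U →ₗ[ℝ] ℝ → EuclideanSpace ℝ (Fin n) :=
      extendTo S c s ∘ₗ (brokenJacobiSpace W a P).subtype ∘ₗ U.subtype
    have hT : ∀ u : U, T u = extendTo S c s u.1.1 := fun _ => rfl
    refine finrank_le_indexOn (M := U) indexForm_zero_right T (fun u => ?_) fun u hu => ?_
    · rw [hT]
      exact hP.extendTo_mem hbij hcs.le u.1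
    · rw [hT, hP.indexForm_extendTo_extendTo hS hSsa hbij hcs.le]
      exact hneg u u.2 fun h => hu (Subtype.ext h)

/-- The null space of the reduced form consists of `P`-Jacobi fields. -/
theorem finrank_ker_reducedForm_le (hP : IsBrokenJacobiInterpolation S a c P)
    (hS : Continuous S) (hSsa : ∀ t x y, (inner ℝ (S t x) y : ℝ) = inner ℝ x (S t y))
    (hbij : Function.Bijective (jacobiBoundary S c t)) (hct : c < t) :
    finrank ℝ (LinearMap.ker (hP.reducedForm hS hSsa σ W t)) ≤ focalMultiplicity S σ W a t := by
  have hac := (hP.piecewiseC1On 0).le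
  have key : ∀ X ∈ LinearMap.ker (hP.reducedForm hS hSsa σ W t),
      (jacobiSolve S c t (X.1 c, 0)).1 ∈ pJacobiVanishingAt S σ W a t ∧
        ∀ x ∈ Icc a c, X.1 x = (jacobiSolve S c t (X.1 c, 0)).1.1 x := by
    intro X hX
    obtain ⟨J, hJ, hXJ⟩ := exists_pJacobi_eqOn (σ := σ) hS (hac.trans_lt hct)
      (hP.extendTo_mem hbij hct.le X) fun U hU => by
        rw [hP.indexForm_extendTo_eq_reducedForm hS hSsa hbij hct.le X hU,
          LinearMap.mem_ker.1 hX, LinearMap.zero_apply]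
    have hsolve : jacobiSolve S c t (X.1 c, 0) = ⟨J, hJ.1.1⟩ :=
      jacobiFields_eq_of_eqOn hS hct fun x hx =>
        (add_jacobiPiece_eqOn_right hbij (hP.eq_zero_of_mem X) 0 hx).symm.trans
          (hXJ x ⟨hac.trans hx.1, hx.2⟩)
    rw [hsolve]
    exact ⟨hJ, fun x hx => (add_jacobiPiece_eqOn_left 0 hx).symm.trans
      (hXJ x ⟨hx.1, hx.2.trans hct.le⟩)⟩
  have := finiteDimensional_pJacobiVanishingAt hS σ W a t
  let ev : (ℝ → EuclideanSpace ℝ (Fin n)) →ₗ[ℝ] EuclideanSpace ℝ (Fin n) := LinearMap.proj c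
  let T : LinearMap.ker (hP.reducedForm hS hSsa σ W t) →ₗ[ℝ] pJacobiVanishingAt S σ W a t :=
    ((jacobiFields S).subtype ∘ₗ jacobiSolve S c t ∘ₗ LinearMap.inl ℝ _ _ ∘ₗ ev ∘ₗ
      (brokenJacobiSpace W a P).subtype ∘ₗ
        (LinearMap.ker (hP.reducedForm hS hSsa σ W t)).subtype).codRestrict _
      fun X => (key X.1 X.2).1
  refine LinearMap.finrank_le_finrank_of_injective (f := T) ?_
  rw [injective_iff_map_eq_zero]
  intro X hX
  have h0 : (jacobiSolve S c t (X.1.1 c, 0)).1 = 0 := congrArg Subtype.val hX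
  refine Subtype.ext (Subtype.ext (funext fun x => ?_))
  by_cases hx : x ∈ Icc a c
  · rw [(key X.1 X.2).2 x hx, h0]
    rfl
  · exact hP.eq_zero_of_mem X.1 x hx

end IsBrokenJacobiInterpolation

/-- Near an instant, the Morse index can only increase, and by at most the multiplicity. -/
theorem eventually_morseIndexFun_le (hS : Continuous S)
    (hSsa : ∀ t x y, (inner ℝ (S t x) y : ℝ) = inner ℝ x (S t y)) (hσ : ∀ x y, σ x y = σ y x)
    (hat : a < t) :
    ∀ᶠ s in 𝓝 t, morseIndexFun S σ W a t ≤ morseIndexFun S σ W a s ∧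
      morseIndexFun S σ W a s ≤ morseIndexFun S σ W a t + focalMultiplicity S σ W a t := by
  obtain ⟨δ, hδ, hpos⟩ := exists_energyPosDefOn hS a (t + 1)
  let c := max a (t - δ / 2)
  have hac : a ≤ c := le_max_left _ _
  have hct : c < t := max_lt hat (by linarith)
  have hcδ : t - δ / 2 ≤ c := le_max_right _ _
  obtain ⟨P, hP⟩ := exists_isBrokenJacobiInterpolation hS hac
  have hnear : ∀ᶠ s in 𝓝 t, c < s ∧ EnergyPosDefOn S c s := by
    have h1 : t < min (t + 1) (t + δ / 2) := lt_min (by linarith) (by linarith)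
    filter_upwards [Ioo_mem_nhds hct h1] with s hs
    have h2 := hs.2.trans_le (min_le_left _ _)
    have h3 := hs.2.trans_le (min_le_right _ _)
    exact ⟨hs.1, hpos c s hac hs.1.le h2.le (by linarith)⟩
  have hbij : ∀ᶠ s in 𝓝 t, Function.Bijective (jacobiBoundary S c s) :=
    hnear.mono fun s hs => hs.2.bijective_jacobiBoundary hS hs.1
  have := hP.finiteDimensional_range
  have : FiniteDimensional ℝ (brokenJacobiSpace W a P) :=
    Submodule.finiteDimensional_of_le (inf_le_left : brokenJacobiSpace W a P ≤ LinearMap.range P)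
  have hbt := hbij.self_of_nhds
  have hlim := eventually_indexOn_le (l := 𝓝 t)
    (hP.tendsto_reducedForm (σ := σ) (W := W) hS hSsa hbij) fun X Y => by
      rw [← hP.indexForm_extendTo_extendTo hS hSsa hbt hct.le,
        ← hP.indexForm_extendTo_extendTo hS hSsa hbt hct.le, indexForm_symm hSsa hσ]
  filter_upwards [hlim, hnear] with s hs hcs
  rw [hP.morseIndexFun_eq hS hSsa hcs.2 hcs.1, hP.morseIndexFun_eq hS hSsa
    hnear.self_of_nhds.2 hct]
  refine ⟨hs.1, hs.2.trans ?_⟩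
  gcongr
  exact_mod_cast hP.finrank_ker_reducedForm_le hS hSsa hbt hct

end Reduction

section Jump

open Filter Topology Module

/-- If `B` is negative definite on the range of `A`, and the range of `Z` is isotropic and
orthogonal to that of `A` but pairs negatively with the range of `X`, then `B` is negative definite
along `A + r⁻¹ • Z + r • X` for some `r`. -/
theorem exists_neg_of_isotropic {M N : Type*} [AddCommGroup M] [Module ℝ M] [FiniteDimensional ℝ M]
    [AddCommGroup N] [Module ℝ N] (B : N →ₗ[ℝ] N →ₗ[ℝ] ℝ) (A Z X : M →ₗ[ℝ] N)
    (hAZ : ∀ x y, B (A x) (Z y) = 0) (hZA : ∀ x y, B (Z x) (A y) = 0)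
    (hZZ : ∀ x y, B (Z x) (Z y) = 0)
    (hneg : ∀ x ≠ 0, B (A x) (A x) + B (Z x) (X x) + B (X x) (Z x) < 0) :
    ∃ T : M →ₗ[ℝ] N, ∀ x ≠ 0, B (T x) (T x) < 0 := by
  let T : ℝ → M →ₗ[ℝ] N := fun r => A + r⁻¹ • Z + r • X
  have hT : ∀ x y, Tendsto (fun r => B.compl₁₂ (T r) (T r) x y) (𝓝[≠] 0)
      (𝓝 ((B.compl₁₂ A A + B.compl₁₂ Z X + B.compl₁₂ X Z) x y)) := by
    intro x y
    have hlim : Tendsto (fun r : ℝ => B (A x) (A y) + B (Z x) (X y) + B (X x) (Z y) +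
        r * (B (A x) (X y) + B (X x) (A y)) + r ^ 2 * B (X x) (X y)) (𝓝[≠] 0)
        (𝓝 (B (A x) (A y) + B (Z x) (X y) + B (X x) (Z y) +
        0 * (B (A x) (X y) + B (X x) (A y)) + 0 ^ 2 * B (X x) (X y))) :=
      (Continuous.tendsto (by fun_prop) 0).mono_left nhdsWithin_le_nhds
    have hval : (B.compl₁₂ A A + B.compl₁₂ Z X + B.compl₁₂ X Z) x y =
        B (A x) (A y) + B (Z x) (X y) + B (X x) (Z y) +
        0 * (B (A x) (X y) + B (X x) (A y)) + 0 ^ 2 * B (X x) (X y) := by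
      simp
    rw [hval]
    refine hlim.congr' ?_
    filter_upwards [self_mem_nhdsWithin] with r hr
    have hr' : r ≠ 0 := hr
    simp only [T, LinearMap.compl₁₂_apply, LinearMap.add_apply, LinearMap.smul_apply, map_add,
      map_smul, smul_eq_mul, hAZ, hZA, hZZ]
    field_simp
    ring
  obtain ⟨r, hr⟩ := (eventually_neg_of_tendsto_bilin hT fun x hx => by simpa using hneg x hx).exists
  exact ⟨T r, hr⟩

variable {n : ℕ} {S : ℝ → EuclideanSpace ℝ (Fin n) →L[ℝ] EuclideanSpace ℝ (Fin n)}
  {σ : EuclideanSpace ℝ (Fin n) →ₗ[ℝ] EuclideanSpace ℝ (Fin n) →ₗ[ℝ] ℝ}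
  {W : Submodule ℝ (EuclideanSpace ℝ (Fin n))} {a s t : ℝ}
  {V U : ℝ → EuclideanSpace ℝ (Fin n)}

/-- The set `HPt W a s` as a subspace. -/
def hptSubmodule (W : Submodule ℝ (EuclideanSpace ℝ (Fin n))) (has : a ≤ s) :
    Submodule ℝ (ℝ → EuclideanSpace ℝ (Fin n)) where
  carrier := HPt W a s
  zero_mem' := ⟨.of_contDiff has contDiff_const, W.zero_mem, rfl⟩
  add_mem' hV hU := ⟨hV.1.add hU.1, W.add_mem hV.2.1 hU.2.1, by simp [hV.2.2, hU.2.2]⟩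
  smul_mem' r V hV := ⟨hV.1.const_smul r, W.smul_mem r hV.2.1, by simp [hV.2.2]⟩

/-- Truncation of maps by zero after the instant `t`. -/
noncomputable def truncateAfter (n : ℕ) (t : ℝ) :
    (ℝ → EuclideanSpace ℝ (Fin n)) →ₗ[ℝ] ℝ → EuclideanSpace ℝ (Fin n) where
  toFun := (Iic t).indicator
  map_add' := indicator_add' _
  map_smul' r := indicator_const_smul _ r

theorem truncateAfter_eqOn_left : EqOn (truncateAfter n t V) V (Icc a t) :=
  fun _ hx => indicator_of_mem (mem_Iic.2 hx.2) _

theorem truncateAfter_eqOn_right (hV : V t = 0) : EqOn (truncateAfter n t V) 0 (Icc t s) := by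
  intro x hx
  rcases hx.1.eq_or_lt with rfl | hlt
  · exact (indicator_of_mem (mem_Iic.2 le_rfl) V).trans hV
  · exact indicator_of_notMem (notMem_Iic.2 hlt) V

theorem truncateAfter_mem (hts : t ≤ s) (hV : V ∈ HPt W a t) :
    truncateAfter n t V ∈ HPt W a s := by
  refine ⟨(hV.1.congr truncateAfter_eqOn_left).trans ((PiecewiseC1On.of_contDiff hts
    contDiff_const).congr (truncateAfter_eqOn_right hV.2.2)), ?_,
    truncateAfter_eqOn_right hV.2.2 (right_mem_Icc.2 hts)⟩
  rw [truncateAfter_eqOn_left (left_mem_Icc.2 hV.1.le)]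
  exact hV.2.1

theorem indexForm_truncateAfter (hS : Continuous S)
    (hSsa : ∀ t x y, (inner ℝ (S t x) y : ℝ) = inner ℝ x (S t y)) (hts : t ≤ s)
    (hV : V ∈ HPt W a t) (hU : PiecewiseC1On a s U) :
    indexForm S σ a s (truncateAfter n t V) U = indexForm S σ a t V U := by
  have hat := hV.1.le
  rw [indexForm_eq_energyForm_sub, indexForm_eq_energyForm_sub,
    ← energyForm_add_adjacent hS (truncateAfter_mem hts hV).1 hU hat hts,
    energyForm_congr hat truncateAfter_eqOn_left (eqOn_refl U _),
    energyForm_congr hts (truncateAfter_eqOn_right hV.2.2) (eqOn_refl U _),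
    truncateAfter_eqOn_left (left_mem_Icc.2 hat), energyForm_symm hSsa (V := 0),
    energyForm_zero_right, add_zero]

theorem indexForm_truncateAfter_truncateAfter (hS : Continuous S)
    (hSsa : ∀ t x y, (inner ℝ (S t x) y : ℝ) = inner ℝ x (S t y)) (hts : t ≤ s)
    (hV : V ∈ HPt W a t) (hU : U ∈ HPt W a t) :
    indexForm S σ a s (truncateAfter n t V) (truncateAfter n t U) = indexForm S σ a t V U := by
  rw [indexForm_truncateAfter hS hSsa hts hV (truncateAfter_mem hts hU).1,
    indexForm_eq_energyForm_sub, indexForm_eq_energyForm_sub,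
    energyForm_congr hV.1.le (eqOn_refl V _) truncateAfter_eqOn_left,
    truncateAfter_eqOn_left (left_mem_Icc.2 hV.1.le)]

theorem fst_mem_HPt (hat : a ≤ t) (k : pJacobiVanishingAt S σ W a t) : k.1.1 ∈ HPt W a t :=
  ⟨.of_contDiff hat k.2.1.1.contDiff, k.2.1.2.1, k.2.2⟩

theorem indexForm_truncateAfter_jacobi (hS : Continuous S)
    (hSsa : ∀ t x y, (inner ℝ (S t x) y : ℝ) = inner ℝ x (S t y)) (hat : a ≤ t) (hts : t ≤ s)
    (k : pJacobiVanishingAt S σ W a t) (hU : U ∈ HPt W a s) :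
    indexForm S σ a s (truncateAfter n t k.1.1) U = inner ℝ (k.1.2 t) (U t) := by
  rw [indexForm_truncateAfter hS hSsa hts (fst_mem_HPt hat k) hU.1, indexForm_eq_energyForm_sub,
    energyForm_eq_of_hasDerivAt hS k.2.1.1.1 k.2.1.1.2 (hU.1.mono le_rfl hat hts)]
  linarith [k.2.1.2.2 (U a) hU.2.1]

/-- The field `x ↦ ((x - a) * (x - s)) • v`. -/
def quadraticField (n : ℕ) (a s : ℝ) :
    EuclideanSpace ℝ (Fin n) →ₗ[ℝ] ℝ → EuclideanSpace ℝ (Fin n) :=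
  LinearMap.pi fun x => ((x - a) * (x - s)) • LinearMap.id

theorem quadraticField_apply (v : EuclideanSpace ℝ (Fin n)) (x : ℝ) :
    quadraticField n a s v x = ((x - a) * (x - s)) • v :=
  rfl

theorem quadraticField_mem (has : a ≤ s) (v : EuclideanSpace ℝ (Fin n)) :
    quadraticField n a s v ∈ HPt W a s := by
  refine ⟨.of_contDiff has ?_, by simp [quadraticField_apply], by simp [quadraticField_apply]⟩
  change ContDiff ℝ 1 fun x : ℝ => ((x - a) * (x - s)) • v
  fun_prop

theorem snd_ne_zero (hS : Continuous S) {k : pJacobiVanishingAt S σ W a t} (hk : k ≠ 0) :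
    k.1.2 t ≠ 0 := by
  intro h0
  have : (⟨k.1, k.2.1.1⟩ : jacobiFields S) = 0 :=
    jacobiCauchy_injective hS t (Prod.ext k.2.2 h0)
  exact hk (Subtype.ext (congrArg (fun J : jacobiFields S => J.1) this))

/-- After an instant, the Morse index has increased at least by the multiplicity. -/
theorem morseIndexFun_add_focalMultiplicity_le (hS : Continuous S)
    (hSsa : ∀ t x y, (inner ℝ (S t x) y : ℝ) = inner ℝ x (S t y)) (hσ : ∀ x y, σ x y = σ y x)
    (hat : a < t) (hts : t < s) :
    morseIndexFun S σ W a t + focalMultiplicity S σ W a t ≤ morseIndexFun S σ W a s := by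
  have has := hat.trans hts
  refine indexOn_add_le (hptSubmodule W hat.le).zero_mem fun U hUH hfd hneg => ?_
  have := finiteDimensional_pJacobiVanishingAt hS σ W a t
  let K := pJacobiVanishingAt S σ W a t
  let H := hptSubmodule W has.le
  let B : H →ₗ[ℝ] H →ₗ[ℝ] ℝ := indexFormPullback hS hSsa σ H.subtype fun V => V.2.1
  let A : (U × K) →ₗ[ℝ] H :=
    (truncateAfter n t ∘ₗ U.subtype ∘ₗ LinearMap.fst ℝ U K).codRestrict H fun x =>
      truncateAfter_mem hts.le (hUH x.1.2)
  let Z : (U × K) →ₗ[ℝ] H :=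
    (truncateAfter n t ∘ₗ LinearMap.fst ℝ _ _ ∘ₗ K.subtype ∘ₗ LinearMap.snd ℝ U K).codRestrict H
      fun x => truncateAfter_mem hts.le (fst_mem_HPt hat.le x.2)
  let ev : (ℝ → EuclideanSpace ℝ (Fin n)) →ₗ[ℝ] EuclideanSpace ℝ (Fin n) := LinearMap.proj t
  let X : (U × K) →ₗ[ℝ] H :=
    (quadraticField n a s ∘ₗ ev ∘ₗ LinearMap.snd ℝ _ _ ∘ₗ K.subtype ∘ₗ
      LinearMap.snd ℝ U K).codRestrict H fun x => quadraticField_mem has.le _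
  have hB : ∀ V V', B V V' = indexForm S σ a s V.1 V'.1 := fun _ _ => rfl
  have hsymm : ∀ V V', B V V' = B V' V := fun V V' => by rw [hB, hB, indexForm_symm hSsa hσ]
  have hAA : ∀ x, B (A x) (A x) = indexForm S σ a t x.1.1 x.1.1 := fun x =>
    indexForm_truncateAfter_truncateAfter hS hSsa hts.le (hUH x.1.2) (hUH x.1.2)
  have hZ : ∀ x V, B (Z x) V = inner ℝ (x.2.1.2 t) (V.1 t) := fun x V =>
    indexForm_truncateAfter_jacobi hS hSsa hat.le hts.le x.2 V.2
  have hAt : ∀ x, (A x).1 t = 0 := fun x =>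
    truncateAfter_eqOn_right (hUH x.1.2).2.2 (left_mem_Icc.2 hts.le)
  have hZt : ∀ x, (Z x).1 t = 0 := fun x =>
    truncateAfter_eqOn_right x.2.2.2 (left_mem_Icc.2 hts.le)
  have hXt : ∀ x, (X x).1 t = ((t - a) * (t - s)) • x.2.1.2 t := fun _ => rfl
  have hZA : ∀ x y, B (Z x) (A y) = 0 := fun x y => by rw [hZ, hAt, inner_zero_right]
  have hZZ : ∀ x y, B (Z x) (Z y) = 0 := fun x y => by rw [hZ, hZt, inner_zero_right]
  have hZX : ∀ x, B (Z x) (X x) = (t - a) * (t - s) * ‖x.2.1.2 t‖ ^ 2 := fun x => by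
    rw [hZ, hXt, real_inner_smul_right, real_inner_self_eq_norm_sq]
  have hcoef : (t - a) * (t - s) < 0 := mul_neg_of_pos_of_neg (by linarith) (by linarith)
  obtain ⟨T, hT⟩ := exists_neg_of_isotropic B A Z X (fun x y => by rw [hsymm, hZA]) hZA hZZ
    fun x hx => by
      rw [hsymm (X x), hAA, hZX]
      by_cases hk : x.2 = 0
      · have hu : x.1 ≠ 0 := fun h => hx (Prod.ext h hk)
        have := hneg x.1 x.1.2 fun h => hu (Subtype.ext h)
        nlinarith [sq_nonneg ‖x.2.1.2 t‖]
      · have h1 : indexForm S σ a t x.1.1 x.1.1 ≤ 0 := by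
          by_cases hu : x.1.1 = 0
          · rw [hu, indexForm_zero_right]
          · exact (hneg x.1 x.1.2 hu).le
        have h2 : 0 < ‖x.2.1.2 t‖ ^ 2 := pow_pos (norm_pos_iff.2 (snd_ne_zero hS hk)) 2
        nlinarith [mul_neg_of_neg_of_pos hcoef h2]
  have hfin := finrank_le_indexOn (M := U × K) (B := indexForm S σ a s) (K := HPt W a s)
    indexForm_zero_right (H.subtype ∘ₗ T) (fun x => (T x).2) hT
  rw [finrank_prod] at hfin
  exact_mod_cast hfin

end Jump

/-- The restricted Morse index function `i(t)` is (1) left continuous on `(a, b]`, and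
(2) for `t ∈ (a, b)` its jump at `t` is the multiplicity `μ^P t`: `i(s) = i(t) + μ^P t`
for all `s > t` sufficiently close to `t`. -/
theorem morseIndexFun_left_continuous_and_jump {n : ℕ}
    (S : ℝ → EuclideanSpace ℝ (Fin n) →L[ℝ] EuclideanSpace ℝ (Fin n))
    (hS : ContDiff ℝ (⊤ : ℕ∞) S)
    (hSsa : ∀ (t : ℝ) (x y : EuclideanSpace ℝ (Fin n)),
      (inner ℝ (S t x) y : ℝ) = inner ℝ x (S t y))
    (σ : EuclideanSpace ℝ (Fin n) →ₗ[ℝ] EuclideanSpace ℝ (Fin n) →ₗ[ℝ] ℝ)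
    (hσ : ∀ x y, σ x y = σ y x)
    (W : Submodule ℝ (EuclideanSpace ℝ (Fin n)))
    (a b : ℝ) (hab : a < b) :
    (∀ t : ℝ, a < t → t ≤ b → ∃ ε > 0, ∀ s : ℝ, t - ε < s → s ≤ t → a < s →
        morseIndexFun S σ W a s = morseIndexFun S σ W a t) ∧
    (∀ t : ℝ, a < t → t < b → ∃ ε > 0, ∀ s : ℝ, t < s → s < t + ε → s ≤ b →
        morseIndexFun S σ W a s =
          morseIndexFun S σ W a t + (focalMultiplicity S σ W a t : ℕ∞)) := by
  have hSc := hS.continuous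
  refine ⟨fun t hat _ => ?_, fun t hat _ => ?_⟩
  · obtain ⟨ε, hε, h⟩ := Metric.eventually_nhds_iff.1
      (eventually_morseIndexFun_le (W := W) hSc hSsa hσ hat)
    refine ⟨ε, hε, fun s hs hst has => ?_⟩
    rcases hst.eq_or_lt with rfl | hlt
    · rfl
    · refine le_antisymm (le_self_add.trans
        (morseIndexFun_add_focalMultiplicity_le hSc hSsa hσ has hlt)) (h ?_).1
      rw [Real.dist_eq, abs_lt]
      constructor <;> linarith
  · obtain ⟨ε, hε, h⟩ := Metric.eventually_nhds_iff.1
      (eventually_morseIndexFun_le (W := W) hSc hSsa hσ hat)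
    refine ⟨ε, hε, fun s hts hs _ => le_antisymm (h ?_).2
      (morseIndexFun_add_focalMultiplicity_le hSc hSsa hσ hat hts)⟩
    rw [Real.dist_eq, abs_lt]
    constructor <;> linarith
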